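/- arXiv:math/0507195 — 4 statements merged into one kernel-verified Lean document; each statement's English description precedes it below -/
import Mathlib

section
/- Let M be a simple weight module over the Virasoro algebra with some infinite-dimensional weight space M_λ. Then there is at most one integer i such that M_{λ+i} is finite-dimensional. -/
/-- Operators `e i` and `c` on `M` that satisfy the relations of the Virasoro algebra and have no
common nontrivial invariant subspace. -/
structure IsSimpleVirasoro {k M : Type*} [Field k] [AddCommGroup M] [Module k M]
    (e : ℤ → Module.End k M) (c : Module.End k M) : Prop where
  central : ∀ i x, c (e i x) = e i (c x)
  bracket : ∀ i j x, e i (e j x) = e j (e i x) + ((j : k) - i) • e (i + j) x +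
    (if i + j = 0 then ((i : k) ^ 3 - (i : k)) / 12 else 0) • c x
  simple : ∀ N : Submodule k M, (∀ i, ∀ x ∈ N, e i x ∈ N) → (∀ x ∈ N, c x ∈ N) → N = ⊥ ∨ N = ⊤

/-- `Descendant e c v d w` says that `w` is obtained from `v` by applying a power of `c` and then
operators `e i` with `i < 0` whose indices add up to `d`. -/
inductive Descendant {k M : Type*} [Field k] [AddCommGroup M] [Module k M]
    (e : ℤ → Module.End k M) (c : Module.End k M) (v : M) : ℤ → M → Prop
  | base (m : ℕ) : Descendant e c v 0 ((c ^ m) v)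
  | step (d i : ℤ) (w : M) (hi : i < 0) (hw : Descendant e c v d w) :
      Descendant e c v (d + i) (e i w)

/-- The span of the descendants of `v` of degree `d`. -/
def descendantSpan {k M : Type*} [Field k] [AddCommGroup M] [Module k M]
    (e : ℤ → Module.End k M) (c : Module.End k M) (v : M) (d : ℤ) : Submodule k M :=
  Submodule.span k {w | Descendant e c v d w}

theorem eigenspace_le_of_iSup_eq_top {k M ι : Type*} [Field k] [AddCommGroup M] [Module k M]
    {f : Module.End k M} {P : ι → Submodule k M} {χ : ι → k} (hχ : Function.Injective χ)
    (hP : ∀ i, P i ≤ f.eigenspace (χ i)) (htop : ⨆ i, P i = ⊤) (i : ι) :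
    f.eigenspace (χ i) ≤ P i := by
  set R : Submodule k M := ⨆ (j : ι) (_ : j ≠ i), P j with hR
  have hsup : P i ⊔ R = ⊤ := by
    rw [eq_top_iff, ← htop]
    refine iSup_le fun j => ?_
    by_cases h : j = i
    · subst h; exact le_sup_left
    · exact le_sup_of_le_right (le_iSup₂_of_le j h le_rfl)
  have hdis : Disjoint (f.eigenspace (χ i)) R := by
    refine ((f.eigenspaces_iSupIndep) (χ i)).mono_right ?_
    refine iSup₂_le fun j hj => ?_
    exact le_iSup₂_of_le (χ j) (fun h => hj (hχ h)) (hP j)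
  calc f.eigenspace (χ i) = (P i ⊔ R) ⊓ f.eigenspace (χ i) := by rw [hsup, top_inf_eq]
    _ = P i ⊔ R ⊓ f.eigenspace (χ i) := (sup_inf_assoc_of_le R (hP i))
    _ = P i := by rw [inf_comm, hdis.eq_bot, sup_bot_eq]
    _ ≤ P i := le_rfl

theorem finiteDimensional_of_map_of_inf_ker {k M : Type*} [Field k] [AddCommGroup M] [Module k M]
    (f : Module.End k M) (V : Submodule k M) (h₁ : FiniteDimensional k (V.map f))
    (h₂ : FiniteDimensional k ↥(V ⊓ LinearMap.ker f)) : FiniteDimensional k V := by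
  rw [FiniteDimensional, Module.Finite.iff_fg] at *
  exact Submodule.fg_of_fg_map_of_fg_inf_ker f h₁ h₂

theorem exists_ne_zero_of_not_finiteDimensional {k M : Type*} [Field k] [AddCommGroup M]
    [Module k M] {V : Submodule k M} (h : ¬ FiniteDimensional k V) : ∃ v ∈ V, v ≠ 0 := by
  refine V.exists_mem_ne_zero_of_ne_bot ?_
  rintro rfl
  exact h inferInstance

namespace IsSimpleVirasoro

variable {k M : Type*} [Field k] [AddCommGroup M] [Module k M]
  {e : ℤ → Module.End k M} {c : Module.End k M}

theorem bracket_of_ne (h : IsSimpleVirasoro e c) {i j : ℤ} (hij : i + j ≠ 0) (x : M) :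
    e i (e j x) = e j (e i x) + ((j : k) - i) • e (i + j) x := by
  rw [h.bracket i j x, if_neg hij, zero_smul, add_zero]

theorem neg (h : IsSimpleVirasoro e c) : IsSimpleVirasoro (fun i => -e (-i)) (-c) where
  central i x := by simp [h.central]
  bracket i j x := by
    have := h.bracket (-i) (-j) x
    simp only [LinearMap.neg_apply, map_neg, neg_neg, this]
    rw [show -i + -j = -(i + j) by ring]
    simp only [neg_eq_zero]
    split_ifs <;> push_cast <;> module
  simple N hN hc := by
    refine h.simple N (fun i x hx => ?_) (fun x hx => ?_)
    · simpa using hN (-i) x hx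
    · simpa using hc x hx

theorem apply_add_mem_eigenspace (h : IsSimpleVirasoro e c) {μ : k} {x : M}
    (hx : x ∈ (e 0).eigenspace μ) (i : ℤ) : e i x ∈ (e 0).eigenspace (μ + i) := by
  rw [Module.End.mem_eigenspace_iff] at *
  rcases eq_or_ne i 0 with rfl | hi
  · simp [hx]
  · rw [h.bracket_of_ne (by simpa using hi), hx, map_smul, zero_add]
    push_cast
    module

/-- If `e i` and `e j` kill `x` then so does their commutator. -/
theorem apply_add_eq_zero [CharZero k] (h : IsSimpleVirasoro e c) {i j n : ℤ} {x : M}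
    (hi : e i x = 0) (hj : e j x = 0) (hn : i + j = n) (hn0 : n ≠ 0) (hij : i ≠ j) :
    e n x = 0 := by
  subst hn
  have := h.bracket_of_ne hn0 x
  rw [hi, hj, map_zero, map_zero, zero_add] at this
  refine (smul_eq_zero.mp this.symm).resolve_left ?_
  rw [sub_eq_zero]
  exact_mod_cast hij.symm

theorem apply_eq_zero_of_pos [CharZero k] (h : IsSimpleVirasoro e c) {x : M}
    (h₁ : e 1 x = 0) (h₂ : e 2 x = 0) {n : ℤ} (hn : 0 < n) : e n x = 0 := by
  have key : ∀ n : ℤ, 2 ≤ n → e n x = 0 := fun n hn => by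
    induction n, hn using Int.leInduction with
    | base => exact h₂
    | succ n hn ih =>
      exact h.apply_add_eq_zero h₁ ih (add_comm _ _) (by lia) (by lia)
  rcases eq_or_lt_of_le (Int.add_one_le_iff.mpr hn) with rfl | h'
  · exact h₁
  · exact key n (by lia)

theorem eq_zero_or_isUnit_of_commute (h : IsSimpleVirasoro e c) {f : Module.End k M}
    (hf : ∀ i x, f (e i x) = e i (f x)) (hfc : ∀ x, f (c x) = c (f x)) :
    f = 0 ∨ IsUnit f := by
  have hker := h.simple (LinearMap.ker f) (fun i x hx => by
    rw [LinearMap.mem_ker] at *; rw [hf, hx, map_zero]) (fun x hx => by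
    rw [LinearMap.mem_ker] at *; rw [hfc, hx, map_zero])
  have hrange := h.simple (LinearMap.range f)
    (by rintro i _ ⟨x, rfl⟩; exact ⟨e i x, hf i x⟩) (by rintro _ ⟨x, rfl⟩; exact ⟨c x, hfc x⟩)
  rcases hker with hk | hk
  · rcases hrange with hr | hr
    · exact Or.inl (LinearMap.range_eq_bot.mp hr)
    · refine Or.inr ((Module.End.isUnit_iff f).mpr ⟨?_, ?_⟩)
      · exact LinearMap.ker_eq_bot.mp hk
      · exact LinearMap.range_eq_top.mp hr
  · exact Or.inl (LinearMap.ker_eq_top.mp hk)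

section HighestWeight

variable {v : M} {μ : k}

theorem descendant_le_zero {d : ℤ} {w : M} (hw : Descendant e c v d w) : d ≤ 0 := by
  induction hw with
  | base m => exact le_rfl
  | step d i w hi hw ih => lia

theorem descendant_central (h : IsSimpleVirasoro e c) {d : ℤ} {w : M}
    (hw : Descendant e c v d w) : Descendant e c v d (c w) := by
  induction hw with
  | base m =>
    rw [← Module.End.mul_apply, ← pow_succ']
    exact .base (m + 1)
  | step d i w hi hw ih =>
    rw [h.central]
    exact .step d i _ hi ih

theorem central_pow_apply (h : IsSimpleVirasoro e c) (m : ℕ) (i : ℤ) (x : M) :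
    (c ^ m) (e i x) = e i ((c ^ m) x) := by
  induction m with
  | zero => rfl
  | succ m ih => rw [pow_succ', Module.End.mul_apply, ih, h.central, Module.End.mul_apply]

theorem descendant_mem_eigenspace (h : IsSimpleVirasoro e c) (hv : v ∈ (e 0).eigenspace μ)
    {d : ℤ} {w : M} (hw : Descendant e c v d w) : w ∈ (e 0).eigenspace (μ + d) := by
  induction hw with
  | base m =>
    rw [Module.End.mem_eigenspace_iff] at *
    rw [← h.central_pow_apply, hv, map_smul, Int.cast_zero, add_zero]
  | step d i w hi hw ih =>
    rw [Int.cast_add, ← add_assoc]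
    exact h.apply_add_mem_eigenspace ih i

theorem apply_mem_descendantSpan_of_neg {d i : ℤ} (hi : i < 0) {w : M}
    (hw : w ∈ descendantSpan e c v d) : e i w ∈ descendantSpan e c v (d + i) := by
  induction hw using Submodule.span_induction with
  | mem x hx => exact Submodule.subset_span (Descendant.step d i x hi hx)
  | zero => rw [map_zero]; exact zero_mem _
  | add x y _ _ hx hy => rw [map_add]; exact add_mem hx hy
  | smul a x _ hx => rw [map_smul]; exact Submodule.smul_mem _ _ hx

theorem descendant_apply_mem (h : IsSimpleVirasoro e c) (hv : v ∈ (e 0).eigenspace μ)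
    (hpos : ∀ i : ℤ, 0 < i → e i v = 0) {d : ℤ} {w : M} (hw : Descendant e c v d w) (j : ℤ) :
    e j w ∈ descendantSpan e c v (d + j) := by
  induction hw generalizing j with
  | base m =>
    rcases lt_trichotomy j 0 with hj | rfl | hj
    · exact Submodule.subset_span (Descendant.step 0 j _ hj (.base m))
    · rw [Module.End.mem_eigenspace_iff.mp (h.descendant_mem_eigenspace hv (.base m)), add_zero]
      exact Submodule.smul_mem _ _ (Submodule.subset_span (Descendant.base m))
    · rw [← h.central_pow_apply, hpos j hj, map_zero]
      exact zero_mem _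
  | step d i w hi hw ih =>
    rw [h.bracket j i w]
    refine add_mem (add_mem ?_ (Submodule.smul_mem _ _ ?_)) ?_
    · have := apply_mem_descendantSpan_of_neg hi (ih j)
      rwa [add_right_comm] at this
    · have := ih (j + i)
      rwa [add_comm j i, ← add_assoc, add_comm i j] at this
    · split_ifs with hji
      · rw [show d + i + j = d by lia]
        exact Submodule.smul_mem _ _ (Submodule.subset_span (h.descendant_central hw))
      · rw [zero_smul]
        exact zero_mem _

theorem iSup_descendantSpan (h : IsSimpleVirasoro e c) (hv0 : v ≠ 0)
    (hv : v ∈ (e 0).eigenspace μ) (hpos : ∀ i : ℤ, 0 < i → e i v = 0) :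
    ⨆ d, descendantSpan e c v d = ⊤ := by
  have hN := h.simple (⨆ d, descendantSpan e c v d) (fun i x hx => ?_) (fun x hx => ?_)
  · refine hN.resolve_left fun hbot => hv0 ?_
    rw [← Submodule.mem_bot k, ← hbot]
    exact Submodule.mem_iSup_of_mem 0 (Submodule.subset_span (Descendant.base 0))
  · have : ⨆ d, descendantSpan e c v d ≤ (⨆ d, descendantSpan e c v d).comap (e i) := by
      refine iSup_le fun d => Submodule.span_le.mpr fun w hw => ?_
      exact Submodule.mem_iSup_of_mem (d + i) (h.descendant_apply_mem hv hpos hw i)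
    exact this hx
  · have : ⨆ d, descendantSpan e c v d ≤ (⨆ d, descendantSpan e c v d).comap c := by
      refine iSup_le fun d => Submodule.span_le.mpr fun w hw => ?_
      exact Submodule.mem_iSup_of_mem d (Submodule.subset_span (h.descendant_central hw))
    exact this hx

theorem eigenspace_le_descendantSpan [CharZero k] (h : IsSimpleVirasoro e c) (hv0 : v ≠ 0)
    (hv : v ∈ (e 0).eigenspace μ) (hpos : ∀ i : ℤ, 0 < i → e i v = 0) (d : ℤ) :
    (e 0).eigenspace (μ + d) ≤ descendantSpan e c v d :=
  eigenspace_le_of_iSup_eq_top (χ := fun d : ℤ => μ + d)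
    (fun a b hab => by simpa using hab)
    (fun _ => Submodule.span_le.mpr fun _ hw => h.descendant_mem_eigenspace hv hw)
    (h.iSup_descendantSpan hv0 hv hpos) d

theorem eq_zero_or_exists_of_descendant {d : ℤ} {w : M} (hw : Descendant e c v d w) :
    (∃ m : ℕ, w = (c ^ m) v) ∧ d = 0 ∨
      ∃ i < 0, ∃ u, Descendant e c v (d - i) u ∧ w = e i u := by
  cases hw with
  | base m => exact Or.inl ⟨⟨m, rfl⟩, rfl⟩
  | step d i w hi hw => exact Or.inr ⟨i, hi, w, by simpa using hw, rfl⟩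

theorem exists_aeval_of_mem_descendantSpan_zero {u : M} (hu : u ∈ descendantSpan e c v 0) :
    ∃ q : Polynomial k, u = Polynomial.aeval c q v := by
  induction hu using Submodule.span_induction with
  | mem x hx =>
    rcases eq_zero_or_exists_of_descendant hx with ⟨⟨m, rfl⟩, -⟩ | ⟨i, hi, u, hu, -⟩
    · exact ⟨Polynomial.X ^ m, by simp⟩
    · have := descendant_le_zero hu
      lia
  | zero => exact ⟨0, by simp⟩
  | add x y _ _ hx hy =>
    obtain ⟨p, rfl⟩ := hx
    obtain ⟨q, rfl⟩ := hy
    exact ⟨p + q, by simp⟩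
  | smul a x _ hx =>
    obtain ⟨p, rfl⟩ := hx
    exact ⟨a • p, by simp⟩

theorem exists_central_eq_smul [CharZero k] [IsAlgClosed k] (h : IsSimpleVirasoro e c)
    (hv0 : v ≠ 0) (hv : v ∈ (e 0).eigenspace μ) (hpos : ∀ i : ℤ, 0 < i → e i v = 0) :
    ∃ a : k, ∀ x, c x = a • x := by
  rcases h.eq_zero_or_isUnit_of_commute h.central (fun _ => rfl) with hc | hc
  · exact ⟨0, fun x => by simp [hc]⟩
  obtain ⟨hinj, hsurj⟩ := (Module.End.isUnit_iff c).mp hc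
  obtain ⟨u, rfl⟩ := hsurj v
  have hu : u ∈ (e 0).eigenspace (μ + (0 : ℤ)) := by
    rw [Module.End.mem_eigenspace_iff] at *
    apply hinj
    rw [h.central, hv, Int.cast_zero, add_zero, map_smul]
  obtain ⟨q, hq⟩ := exists_aeval_of_mem_descendantSpan_zero
    (h.eigenspace_le_descendantSpan hv0 hv hpos 0 hu)
  set p : Polynomial k := Polynomial.X * q - 1 with hp
  have hp0 : p ≠ 0 := fun hp0 => by
    have := congrArg (Polynomial.eval 0) hp0
    simp [hp] at this
  have hpv : Polynomial.aeval c p (c u) = 0 := by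
    rw [hp, map_sub, map_mul, map_one, Polynomial.aeval_X, LinearMap.sub_apply,
      Module.End.mul_apply, ← hq, Module.End.one_apply, sub_self]
  have hnot : ¬ IsUnit (Polynomial.aeval c
      (p.roots.map fun a => Polynomial.X - Polynomial.C a).prod) := by
    intro hunit
    have hsplit := (IsAlgClosed.splits p).eq_prod_roots
    rw [hsplit, map_mul, Polynomial.aeval_C, Module.End.mul_apply,
      Module.algebraMap_end_apply] at hpv
    have := (smul_eq_zero.mp hpv).resolve_left (Polynomial.leadingCoeff_ne_zero.mpr hp0)
    exact hv0 (((Module.End.isUnit_iff _).mp hunit).1 (this.trans (map_zero _).symm))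
  obtain ⟨a, ha, -⟩ := spectrum.exists_mem_of_not_isUnit_aeval_prod hnot
  refine ⟨a, fun x => ?_⟩
  have := (h.eq_zero_or_isUnit_of_commute (f := algebraMap k _ a - c)
    (fun i x => by simp [h.central]) (fun x => by simp)).resolve_right ha
  have := LinearMap.congr_fun this x
  rw [LinearMap.sub_apply, Module.algebraMap_end_apply, LinearMap.zero_apply, sub_eq_zero] at this
  exact this.symm

theorem finiteDimensional_descendantSpan {a : k} (ha : ∀ x, c x = a • x) (n : ℕ) :
    FiniteDimensional k (descendantSpan e c v (-n)) := by
  induction n using Nat.strong_induction_on with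
  | _ n ih =>
  have hfin : ∀ i : Finset.Ico (-n : ℤ) 0,
      FiniteDimensional k (descendantSpan e c v (-n - i)) := by
    rintro ⟨i, hi⟩
    rw [Finset.mem_Ico] at hi
    have := ih (n + i).toNat (by lia)
    rwa [show (-((n + i).toNat : ℤ)) = -n - i by lia] at this
  have hle : descendantSpan e c v (-n) ≤ Submodule.span k {v} ⊔
      ⨆ i : Finset.Ico (-n : ℤ) 0, (descendantSpan e c v (-n - i)).map (e i) := by
    refine Submodule.span_le.mpr fun w hw => ?_
    rcases eq_zero_or_exists_of_descendant hw with ⟨⟨m, rfl⟩, -⟩ | ⟨i, hi, u, hu, rfl⟩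
    · refine Submodule.mem_sup_left (Submodule.mem_span_singleton.mpr ⟨a ^ m, ?_⟩)
      clear hw
      induction m with
      | zero => simp
      | succ m ih' =>
        rw [pow_succ', pow_succ', Module.End.mul_apply, ha, mul_smul, ih']
    · have := descendant_le_zero hu
      refine Submodule.mem_sup_right (Submodule.mem_iSup_of_mem
        ⟨i, Finset.mem_Ico.mpr ⟨by lia, hi⟩⟩ ?_)
      exact Submodule.mem_map_of_mem (Submodule.subset_span hu)
  exact Submodule.finiteDimensional_of_le hle

/-- A simple module with a singular weight vector has finite-dimensional weight spaces. -/
theorem finiteDimensional_of_singular [CharZero k] [IsAlgClosed k] (h : IsSimpleVirasoro e c)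
    (hv0 : v ≠ 0) (hv : v ∈ (e 0).eigenspace μ) (h₁ : e 1 v = 0) (h₂ : e 2 v = 0) (d : ℤ) :
    FiniteDimensional k ((e 0).eigenspace (μ + d)) := by
  have hpos : ∀ i : ℤ, 0 < i → e i v = 0 := fun i => h.apply_eq_zero_of_pos h₁ h₂
  obtain ⟨a, ha⟩ := h.exists_central_eq_smul hv0 hv hpos
  have hle := h.eigenspace_le_descendantSpan hv0 hv hpos d
  rcases le_or_gt d 0 with hd | hd
  · have := finiteDimensional_descendantSpan (e := e) (v := v) ha (-d).toNat
    rw [show (-((-d).toNat : ℤ)) = d by lia] at this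
    exact Submodule.finiteDimensional_of_le hle
  · have hbot : descendantSpan e c v d = ⊥ := by
      refine Submodule.span_eq_bot.mpr fun w hw => ?_
      have := descendant_le_zero hw
      lia
    rw [hbot] at hle
    exact Submodule.finiteDimensional_of_le hle

theorem eigenspace_neg_zero (μ : k) :
    (-e (-0)).eigenspace (-μ) = (e 0).eigenspace μ := by
  ext x
  simp

theorem finiteDimensional_of_singular_neg [CharZero k] [IsAlgClosed k]
    (h : IsSimpleVirasoro e c) (hv0 : v ≠ 0) (hv : v ∈ (e 0).eigenspace μ) (h₁ : e (-1) v = 0)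
    (h₂ : e (-2) v = 0) (d : ℤ) : FiniteDimensional k ((e 0).eigenspace (μ + d)) := by
  rw [← eigenspace_neg_zero] at hv
  have := h.neg.finiteDimensional_of_singular hv0 hv (by simpa using h₁) (by simpa using h₂) (-d)
  rw [← eigenspace_neg_zero]
  rwa [neg_add, ← Int.cast_neg]

end HighestWeight

section InfiniteWeightSpace

theorem apply_neg_eq_zero [CharZero k] (h : IsSimpleVirasoro e c) {x : M} (h₁ : e 1 x = 0) {l m : ℤ}
    (hl : e (-l) x = 0) (hm : 0 < m) (hml : m ≤ l) : e (-m) x = 0 := by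
  induction m, hml using Int.leInductionDown with
  | base => exact hl
  | pred m hml ih =>
    exact h.apply_add_eq_zero h₁ (ih (by lia)) (by lia) (by lia) (by lia)

variable [CharZero k] [IsAlgClosed k] {lam : k}

/-- An infinite-dimensional subspace of a weight space cannot be killed by `e 1` and all `e i`
with `i` large if the next weight space is finite-dimensional. -/
theorem finiteDimensional_of_killed (h : IsSimpleVirasoro e c)
    (hinf : ¬ FiniteDimensional k ((e 0).eigenspace lam))
    (hone : FiniteDimensional k ((e 0).eigenspace (lam + 1))) {j : ℤ} (hj : 2 ≤ j)
    (V : Submodule k M) (hV : V ≤ (e 0).eigenspace lam) (h₁ : ∀ x ∈ V, e 1 x = 0)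
    (hk : ∀ i ≥ j, ∀ x ∈ V, e i x = 0) : FiniteDimensional k V := by
  induction j, hj using Int.leInduction generalizing V with
  | base =>
    by_contra hVinf
    obtain ⟨v, hvV, hv0⟩ := exists_ne_zero_of_not_finiteDimensional hVinf
    have := h.finiteDimensional_of_singular hv0 (hV hvV) (h₁ v hvV) (hk 2 le_rfl v hvV) 0
    rw [Int.cast_zero, add_zero] at this
    exact hinf this
  | succ l hl ih =>
    refine finiteDimensional_of_map_of_inf_ker (e l) V ?_
      (ih _ (inf_le_left.trans hV) (fun x hx => h₁ x hx.1) fun i hi x hx => ?_)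
    · refine finiteDimensional_of_map_of_inf_ker (e (1 - l)) _ ?_ ?_
      · refine Submodule.finiteDimensional_of_le (S₂ := (e 0).eigenspace (lam + 1)) ?_
        rintro _ ⟨_, ⟨x, hx, rfl⟩, rfl⟩
        have := h.apply_add_mem_eigenspace (h.apply_add_mem_eigenspace (hV hx) l) (1 - l)
        rwa [add_assoc, ← Int.cast_add, add_sub_cancel, Int.cast_one] at this
      · by_contra hWinf
        obtain ⟨w, ⟨⟨x, hx, rfl⟩, hw⟩, hw0⟩ := exists_ne_zero_of_not_finiteDimensional hWinf
        replace hw : e (1 - l) (e l x) = 0 := hw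
        have hwt := h.apply_add_mem_eigenspace (hV hx) l
        have hkill : ∀ i ≥ 1, e i x = 0 → e i (e l x) = 0 := fun i hi hix => by
          rw [h.bracket_of_ne (by lia), hix, map_zero, hk (i + l) (by lia) x hx, smul_zero,
            add_zero]
        have hw₁ := hkill 1 le_rfl (h₁ x hx)
        have hfin : FiniteDimensional k ((e 0).eigenspace (lam + l + (-l : ℤ))) := by
          rcases eq_or_lt_of_le hl with rfl | hl
          · have hw₃ := hkill 3 (by lia) (hk 3 (by lia) x hx)
            exact h.finiteDimensional_of_singular hw0 hwt hw₁
              (h.apply_add_eq_zero hw hw₃ (by lia) (by lia) (by lia)) _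
          · rw [show 1 - l = -(l - 1) by ring] at hw
            exact h.finiteDimensional_of_singular_neg hw0 hwt
              (h.apply_neg_eq_zero hw₁ hw (by lia) (by lia))
              (h.apply_neg_eq_zero hw₁ hw (by lia) (by lia)) _
        rw [Int.cast_neg, add_neg_cancel_right] at hfin
        exact hinf hfin
    · rcases eq_or_lt_of_le hi with rfl | hi
      · exact hx.2
      · exact hk i hi x hx.1

theorem finiteDimensional_of_right (h : IsSimpleVirasoro e c)
    (hone : FiniteDimensional k ((e 0).eigenspace (lam + 1))) {j : ℤ} (hj : 2 ≤ j)
    (hjfin : FiniteDimensional k ((e 0).eigenspace (lam + j))) :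
    FiniteDimensional k ((e 0).eigenspace lam) := by
  by_contra hinf
  have hmap : ∀ (i : ℤ) (V : Submodule k M), V ≤ (e 0).eigenspace lam →
      FiniteDimensional k ((e 0).eigenspace (lam + i)) → FiniteDimensional k (V.map (e i)) := by
    intro i V hV hi
    refine Submodule.finiteDimensional_of_le (S₂ := (e 0).eigenspace (lam + i)) ?_
    rintro _ ⟨x, hx, rfl⟩
    exact h.apply_add_mem_eigenspace (hV hx) i
  refine hinf (finiteDimensional_of_map_of_inf_ker (e 1) _ (hmap 1 _ le_rfl (by rwa [Int.cast_one]))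
    (finiteDimensional_of_map_of_inf_ker (e j) _ (hmap j _ inf_le_left hjfin)
      (h.finiteDimensional_of_killed hinf hone hj _ (inf_le_left.trans inf_le_left)
        (fun x hx => hx.1.2) fun i hi x hx => ?_)))
  induction i, hi using Int.leInduction with
  | base => exact hx.2
  | succ i hi ih => exact h.apply_add_eq_zero hx.1.2 ih (by lia) (by lia) (by lia)

theorem finiteDimensional_of_left (h : IsSimpleVirasoro e c)
    (hone : FiniteDimensional k ((e 0).eigenspace (lam - 1)))
    (htwo : FiniteDimensional k ((e 0).eigenspace (lam - 2))) :
    FiniteDimensional k ((e 0).eigenspace lam) := by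
  rw [← eigenspace_neg_zero, neg_sub', sub_neg_eq_add] at hone htwo
  rw [← eigenspace_neg_zero]
  refine h.neg.finiteDimensional_of_right (j := 2) hone le_rfl ?_
  rwa [Int.cast_ofNat]

theorem finiteDimensional_of_lt (h : IsSimpleVirasoro e c) {i j : ℤ} (hij : i < j)
    (hi : FiniteDimensional k ((e 0).eigenspace (lam + i)))
    (hj : FiniteDimensional k ((e 0).eigenspace (lam + j))) (n : ℤ) :
    FiniteDimensional k ((e 0).eigenspace (lam + n)) := by
  have hle : ∀ n ≤ i, FiniteDimensional k ((e 0).eigenspace (lam + n)) := fun n hn => by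
    induction n, hn using Int.leInductionDown with
    | base => exact hi
    | pred n hn ih =>
      refine h.finiteDimensional_of_right (j := j - n + 1) ?_ (by lia) ?_
      · rwa [Int.cast_sub, Int.cast_one, add_assoc, sub_add_cancel]
      · rwa [add_assoc, ← Int.cast_add, show n - 1 + (j - n + 1) = j by ring]
  rcases le_total n i with hn | hn
  · exact hle n hn
  suffices FiniteDimensional k ((e 0).eigenspace (lam + n)) ∧
      FiniteDimensional k ((e 0).eigenspace (lam + (n - 1 : ℤ))) from this.1
  induction n, hn using Int.leInduction with
  | base => exact ⟨hi, hle _ (by lia)⟩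
  | succ n hn ih =>
    rw [add_sub_cancel_right]
    refine ⟨h.finiteDimensional_of_left ?_ ?_, ih.1⟩
    · rw [show lam + ↑(n + 1) - 1 = lam + (n : k) by push_cast; ring]
      exact ih.1
    · rw [show lam + ↑(n + 1) - 2 = lam + ((n - 1 : ℤ) : k) by push_cast; ring]
      exact ih.2

end InfiniteWeightSpace

end IsSimpleVirasoro

theorem LieModule.isSimpleVirasoro {k L M : Type*} [Field k] [LieRing L] [LieAlgebra k L]
    (E : ℤ → L) (C : L) (hC : ∀ z : L, ⁅C, z⁆ = 0)
    (hE : ∀ i j : ℤ, ⁅E i, E j⁆ =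
      (j - i) • E (i + j) + (if i + j = 0 then ((i : k) ^ 3 - (i : k)) / 12 else 0) • C)
    (hspan : Submodule.span k ({C} ∪ Set.range E) = ⊤)
    [AddCommGroup M] [Module k M] [LieRingModule L M] [LieModule k L M]
    [LieModule.IsIrreducible k L M] :
    IsSimpleVirasoro (fun i => LieModule.toEnd k L M (E i)) (LieModule.toEnd k L M C) where
  central i x := by
    simp only [LieModule.toEnd_apply_apply]
    rw [leibniz_lie, hC, zero_lie, zero_add]
  bracket i j x := by
    simp only [LieModule.toEnd_apply_apply]
    rw [leibniz_lie, hE, add_lie, smul_lie, ← Int.cast_smul_eq_zsmul k, smul_lie]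
    push_cast
    abel
  simple N hN hc := by
    have hmem : ∀ z : L, ∀ x ∈ N, ⁅z, x⁆ ∈ N := fun z x hx => by
      have hz : z ∈ Submodule.span k ({C} ∪ Set.range E) := hspan ▸ Submodule.mem_top
      induction hz using Submodule.span_induction with
      | mem y hy =>
        rcases hy with rfl | ⟨i, rfl⟩
        · exact hc x hx
        · exact hN i x hx
      | zero => rw [zero_lie]; exact zero_mem _
      | add y z _ _ hy hz => rw [add_lie]; exact add_mem hy hz
      | smul a y _ hy => rw [smul_lie]; exact Submodule.smul_mem _ _ hy
    let N' : LieSubmodule k L M := { N with lie_mem := fun {z x} hx => hmem z x hx }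
    have hN' : (N' : Submodule k M) = N := rfl
    rw [← hN']
    rcases eq_bot_or_eq_top N' with h | h
    · left; rw [h]; rfl
    · right; rw [h]; rfl


/-- Let `M` be a simple weight module over the Virasoro algebra with some
infinite-dimensional weight space `M_λ`.  Then there is at most one integer
`i` such that `M_{λ+i}` is finite-dimensional. -/
theorem virasoro_at_most_one_finite_weight_space
    {k : Type*} [Field k] [CharZero k] [IsAlgClosed k]
    {L : Type*} [LieRing L] [LieAlgebra k L]
    (E : ℤ → L) (C : L)
    (hC : ∀ z : L, ⁅C, z⁆ = 0)
    (hE : ∀ i j : ℤ, ⁅E i, E j⁆ =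
      (j - i) • E (i + j) + (if i + j = 0 then ((i : k) ^ 3 - (i : k)) / 12 else 0) • C)
    (hspan : Submodule.span k ({C} ∪ Set.range E) = ⊤)
    {M : Type*} [AddCommGroup M] [Module k M] [LieRingModule L M] [LieModule k L M]
    [LieModule.IsIrreducible k L M]
    (hweight : (⨆ μ : k, Module.End.eigenspace (LieModule.toEnd k L M (E 0)) μ) = ⊤)
    (lam : k)
    (hinf : ¬ FiniteDimensional k
      ↥(Module.End.eigenspace (LieModule.toEnd k L M (E 0)) lam)) :
    ∀ i j : ℤ,
      FiniteDimensional k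
        ↥(Module.End.eigenspace (LieModule.toEnd k L M (E 0)) (lam + i)) →
      FiniteDimensional k
        ↥(Module.End.eigenspace (LieModule.toEnd k L M (E 0)) (lam + j)) →
      i = j := by
  intro i j hi hj
  have h := LieModule.isSimpleVirasoro (M := M) E C hC hE hspan
  by_contra hij
  refine hinf ?_
  rcases lt_or_gt_of_ne hij with hlt | hlt
  · have := h.finiteDimensional_of_lt hlt hi hj 0
    rwa [Int.cast_zero, add_zero] at this
  · have := h.finiteDimensional_of_lt hlt hj hi 0
    rwa [Int.cast_zero, add_zero] at this
end

section
/- Let M be a simple weight module over the Virasoro algebra. If some weight space M_λ is infinite-dimensional, then supp(M) = λ + ℤ and every weight space M_{λ+k}, k ∈ ℤ, is infinite-dimensional. -/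
/-- A representation of the Virasoro algebra, given by the operators of its standard basis. -/
structure VirasoroRep (k M : Type*) [Field k] [AddCommGroup M] [Module k M] where
  e : ℤ → Module.End k M
  c : Module.End k M
  e_c : ∀ (i : ℤ) (v : M), e i (c v) = c (e i v)
  e_e : ∀ (i j : ℤ) (v : M), e i (e j v) = e j (e i v) + ((j : k) - i) • e (i + j) v +
    (if i + j = 0 then ((i : k) ^ 3 - i) / 12 else 0) • c v

namespace VirasoroRep

variable {k M : Type*} [Field k] [AddCommGroup M] [Module k M] (ρ : VirasoroRep k M)

/-- The subspace of vectors of weight `μ`. -/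
def weightSpace (μ : k) : Submodule k M := Module.End.eigenspace (ρ.e 0) μ

/-- Every invariant subspace is trivial. -/
def IsSimple : Prop :=
  ∀ N : Submodule k M, (∀ i, ∀ v ∈ N, ρ.e i v ∈ N) → (∀ v ∈ N, ρ.c v ∈ N) → N = ⊥ ∨ N = ⊤

/-- There is no nonzero weight vector killed by all `e i` with `i > 0`. -/
def NoHighest : Prop :=
  ∀ (μ : k) (v : M), ρ.e 0 v = μ • v → ρ.e 1 v = 0 → ρ.e 2 v = 0 → v = 0

/-- The twist of a representation by the involution `e i ↦ - e (-i)`, `c ↦ - c`. -/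
def twist : VirasoroRep k M where
  e i := - ρ.e (-i)
  c := - ρ.c
  e_c i v := by simp [ρ.e_c]
  e_e i j v := by
    have h := ρ.e_e (-i) (-j) v
    have h1 : -i + -j = -(i + j) := by ring
    rw [h1] at h
    simp only [LinearMap.neg_apply, map_neg, neg_neg, h, neg_eq_zero]
    split_ifs <;> push_cast <;> module

@[simp] lemma twist_e (i : ℤ) (v : M) : ρ.twist.e i v = - ρ.e (-i) v := rfl

@[simp] lemma twist_c (v : M) : ρ.twist.c v = - ρ.c v := rfl

lemma mem_weightSpace {μ : k} {v : M} : v ∈ ρ.weightSpace μ ↔ ρ.e 0 v = μ • v :=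
  Module.End.mem_eigenspace_iff

lemma weightSpace_twist (μ : k) : ρ.twist.weightSpace μ = ρ.weightSpace (-μ) := by
  ext v
  simp only [mem_weightSpace, twist_e, neg_zero, neg_smul]
  exact neg_eq_iff_eq_neg

lemma IsSimple.twist {ρ : VirasoroRep k M} (h : ρ.IsSimple) : ρ.twist.IsSimple := by
  intro N hN hc
  refine h N (fun i v hv => ?_) (fun v hv => ?_)
  · simpa using hN (-i) v hv
  · simpa using hc v hv

lemma e_e_of_add_eq {i j n : ℤ} (h : i + j = n) (hn : n ≠ 0) (v : M) :
    ρ.e i (ρ.e j v) = ρ.e j (ρ.e i v) + ((j : k) - i) • ρ.e n v := by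
  rw [ρ.e_e, h, if_neg hn, zero_smul, add_zero]

lemma e_e_neg (i : ℤ) (v : M) :
    ρ.e i (ρ.e (-i) v) = ρ.e (-i) (ρ.e i v) + (-2 * (i : k)) • ρ.e 0 v +
      (((i : k) ^ 3 - i) / 12) • ρ.c v := by
  rw [ρ.e_e, add_neg_cancel, if_pos rfl]
  push_cast
  module

lemma e_zero_e (i : ℤ) (v : M) : ρ.e 0 (ρ.e i v) = ρ.e i (ρ.e 0 v) + (i : k) • ρ.e i v := by
  rw [ρ.e_e 0 i]
  simp

lemma e_mem {μ ν : k} {i : ℤ} (h : ν = μ + i) {v : M} (hv : v ∈ ρ.weightSpace μ) :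
    ρ.e i v ∈ ρ.weightSpace ν := by
  rw [mem_weightSpace] at hv ⊢
  rw [e_zero_e, hv, map_smul, h]
  module

lemma c_mem {μ : k} {v : M} (hv : v ∈ ρ.weightSpace μ) : ρ.c v ∈ ρ.weightSpace μ := by
  rw [mem_weightSpace] at hv ⊢
  rw [ρ.e_c, hv, map_smul]

lemma comm (i j n : ℤ) (r : k) (v : M) (h : i + j = n := by norm_num)
    (hn : n ≠ 0 := by norm_num) (hr : (j : k) - i = r := by norm_num) :
    ρ.e i (ρ.e j v) = ρ.e j (ρ.e i v) + r • ρ.e n v := by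
  rw [ρ.e_e_of_add_eq h hn, hr]

section Generation

variable {ι : Type*} {S : ι → Submodule k M} {ν : ι → k}

lemma weightSpace_le_of_iSup_eq_top (hS : ∀ i, S i ≤ ρ.weightSpace (ν i)) (htop : ⨆ i, S i = ⊤)
    (μ : k) : ρ.weightSpace μ ≤ ⨆ (i) (_ : ν i = μ), S i := by
  intro x hx
  have hsup : (⨆ (i) (_ : ν i = μ), S i) ⊔ (⨆ (i) (_ : ν i ≠ μ), S i) = ⊤ := by
    rw [eq_top_iff, ← htop]
    refine iSup_le fun i => ?_
    by_cases h : ν i = μ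
    · exact le_sup_of_le_left (le_iSup₂_of_le i h le_rfl)
    · exact le_sup_of_le_right (le_iSup₂_of_le i h le_rfl)
  have hxt : x ∈ (⊤ : Submodule k M) := trivial
  rw [← hsup] at hxt
  obtain ⟨a, ha, b, hb, rfl⟩ := Submodule.mem_sup.1 hxt
  have ha' : a ∈ ρ.weightSpace μ :=
    (iSup₂_le fun i (h : ν i = μ) => h ▸ hS i : (⨆ (i) (_ : ν i = μ), S i) ≤ _) ha
  have hb' : b ∈ ⨆ (μ') (_ : μ' ≠ μ), ρ.weightSpace μ' :=
    (iSup₂_le fun i (h : ν i ≠ μ) => (hS i).trans (le_iSup₂_of_le (ν i) h le_rfl) :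
      (⨆ (i) (_ : ν i ≠ μ), S i) ≤ _) hb
  have hb'' : b ∈ ρ.weightSpace μ := by simpa using Submodule.sub_mem _ hx ha'
  have hind := (Module.End.eigenspaces_iSupIndep (ρ.e 0)) μ
  have : b = 0 := Submodule.disjoint_def.1 hind b hb'' hb'
  simpa [this] using ha

lemma weightSpace_le_of_injective (hν : Function.Injective ν)
    (hS : ∀ i, S i ≤ ρ.weightSpace (ν i)) (htop : ⨆ i, S i = ⊤) (i : ι) :
    ρ.weightSpace (ν i) ≤ S i :=
  (ρ.weightSpace_le_of_iSup_eq_top hS htop (ν i)).trans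
    (iSup₂_le fun j h => by rw [hν h])

lemma weightSpace_eq_bot (hS : ∀ i, S i ≤ ρ.weightSpace (ν i)) (htop : ⨆ i, S i = ⊤) {μ : k}
    (hμ : ∀ i, ν i ≠ μ) : ρ.weightSpace μ = ⊥ :=
  eq_bot_iff.2 <| (ρ.weightSpace_le_of_iSup_eq_top hS htop μ).trans
    (iSup₂_le fun j h => absurd h (hμ j))

lemma IsSimple.iSup_eq_top {ρ : VirasoroRep k M} (hρ : ρ.IsSimple)
    (he : ∀ i n, ∀ v ∈ S n, ρ.e i v ∈ ⨆ n, S n) (hc : ∀ n, ∀ v ∈ S n, ρ.c v ∈ ⨆ n, S n)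
    {n : ι} {v : M} (hv : v ∈ S n) (hv0 : v ≠ 0) : ⨆ n, S n = ⊤ := by
  have key : ∀ f : Module.End k M, (∀ n, ∀ v ∈ S n, f v ∈ ⨆ n, S n) →
      ∀ v ∈ ⨆ n, S n, f v ∈ ⨆ n, S n := by
    intro f hf
    have : ⨆ n, S n ≤ (⨆ n, S n).comap f := iSup_le fun n v hv => hf n v hv
    exact this
  refine (hρ _ (fun i => key _ (he i)) (key _ hc)).resolve_left fun h => hv0 ?_
  have := Submodule.mem_iSup_of_mem n hv
  rwa [h, Submodule.mem_bot] at this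

end Generation

lemma IsSimple.iSup_weightSpace {ρ : VirasoroRep k M} (hρ : ρ.IsSimple) {μ : k}
    (h : ρ.weightSpace μ ≠ ⊥) : ⨆ n : ℤ, ρ.weightSpace (μ + n) = ⊤ := by
  obtain ⟨v, hv, hv0⟩ := Submodule.exists_mem_ne_zero_of_ne_bot h
  refine hρ.iSup_eq_top (n := (0 : ℤ)) (v := v) (fun i n v hv => ?_) (fun n v hv => ?_)
    (by simpa using hv) hv0
  · exact Submodule.mem_iSup_of_mem (n + i) (ρ.e_mem (by push_cast; ring) hv)
  · exact Submodule.mem_iSup_of_mem n (ρ.c_mem hv)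

section HighestWeight

/-- The part of depth `n` of the subrepresentation generated by a highest weight vector `v`. -/
noncomputable def depth (v : M) : ℕ → Submodule k M
  | 0 => LinearMap.range ((LinearMap.applyₗ v) ∘ₗ (Polynomial.aeval (R := k) ρ.c).toLinearMap)
  | n + 1 => ⨆ i : Fin (n + 1), (depth v (n - i)).map (ρ.e (-((i : ℕ) + 1 : ℤ)))

lemma mem_depth_zero {v x : M} :
    x ∈ ρ.depth v 0 ↔ ∃ q : Polynomial k, Polynomial.aeval ρ.c q v = x := by
  rw [depth]
  simp

lemma e_mem_depth {v x : M} {n m : ℕ} (hx : x ∈ ρ.depth v n) :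
    ρ.e (-((m : ℤ) + 1)) x ∈ ρ.depth v (n + m + 1) := by
  rw [depth]
  refine Submodule.mem_iSup_of_mem ⟨m, by omega⟩ (Submodule.mem_map_of_mem ?_)
  simpa using hx

lemma depth_induction {v : M} {P : ℕ → M → Prop}
    (h0 : ∀ q : Polynomial k, P 0 (Polynomial.aeval ρ.c q v))
    (hadd : ∀ n x y, P n x → P n y → P n (x + y)) (hz : ∀ n, P n 0)
    (hs : ∀ n m x, x ∈ ρ.depth v n → P n x → P (n + m + 1) (ρ.e (-((m : ℤ) + 1)) x)) :
    ∀ n, ∀ x ∈ ρ.depth v n, P n x := by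
  intro n
  induction n using Nat.strong_induction_on with
  | _ n ih =>
    intro x hx
    cases n with
    | zero =>
      obtain ⟨q, rfl⟩ := ρ.mem_depth_zero.1 hx
      exact h0 q
    | succ n =>
      rw [depth] at hx
      refine Submodule.iSup_induction _ (motive := P (n + 1)) hx ?_ (hz _) (hadd _)
      rintro ⟨i, hi⟩ _ ⟨y, hy, rfl⟩
      have := hs (n - i) i y hy (ih _ (by omega) y hy)
      rwa [show n - i + i + 1 = n + 1 by omega] at this

lemma e_aeval (i : ℤ) (q : Polynomial k) (v : M) :
    ρ.e i (Polynomial.aeval ρ.c q v) = Polynomial.aeval ρ.c q (ρ.e i v) := by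
  have hcomm : Commute ρ.c (ρ.e i) := by
    ext v
    simp [ρ.e_c]
  induction q using Polynomial.induction_on' with
  | add p q hp hq => simp [hp, hq]
  | monomial n a =>
    simp only [Polynomial.aeval_monomial, Module.End.mul_apply, Module.algebraMap_end_apply,
      map_smul]
    congr 1
    exact (LinearMap.congr_fun ((hcomm.pow_left n).eq) v).symm

lemma e_pos_eq_zero [CharZero k] {v : M} (h1 : ρ.e 1 v = 0) (h2 : ρ.e 2 v = 0) (n : ℕ) :
    ρ.e (n + 1) v = 0 := by
  induction n with
  | zero => simpa using h1
  | succ n ih =>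
    rcases Nat.eq_zero_or_pos n with rfl | hn
    · simpa using h2
    have h := ρ.e_e_of_add_eq (i := 1) (j := n + 1) (n := n + 1 + 1) (by ring) (by omega) v
    rw [ih, h1, map_zero, map_zero, zero_add] at h
    have hn' : (((n + 1 : ℤ) : k) - ((1 : ℤ) : k)) ≠ 0 := by
      push_cast
      simpa using hn.ne'
    simpa using (smul_eq_zero.1 h.symm).resolve_left hn'

lemma depth_le_weightSpace {v : M} {μ : k} (hv : v ∈ ρ.weightSpace μ) (n : ℕ) :
    ρ.depth v n ≤ ρ.weightSpace (μ - n) := by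
  intro x hx
  refine ρ.depth_induction (v := v) (P := fun n x => x ∈ ρ.weightSpace (μ - n)) ?_
    (fun n x y => Submodule.add_mem _) (fun n => Submodule.zero_mem _) ?_ n x hx
  · intro q
    rw [mem_weightSpace] at hv ⊢
    rw [e_aeval, hv]
    simp
  · intro n m x _ hx
    exact ρ.e_mem (by push_cast; ring) hx

lemma IsSimple.iSup_depth [CharZero k] {ρ : VirasoroRep k M} (hρ : ρ.IsSimple) {v : M} {μ : k}
    (hv : v ∈ ρ.weightSpace μ) (hv0 : v ≠ 0) (h1 : ρ.e 1 v = 0) (h2 : ρ.e 2 v = 0) :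
    ⨆ n, ρ.depth v n = ⊤ := by
  have hneg : ∀ (m : ℕ) x, x ∈ ⨆ n, ρ.depth v n →
      ρ.e (-((m : ℤ) + 1)) x ∈ ⨆ n, ρ.depth v n := by
    intro m
    have : ⨆ n, ρ.depth v n ≤ (⨆ n, ρ.depth v n).comap (ρ.e (-((m : ℤ) + 1))) :=
      iSup_le fun n x hx => Submodule.mem_iSup_of_mem _ (ρ.e_mem_depth hx)
    exact this
  have hc : ∀ n, ∀ x ∈ ρ.depth v n, ρ.c x ∈ ρ.depth v n := by
    refine ρ.depth_induction ?_ (fun n x y hx hy => ?_) (fun n => by simp) ?_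
    · intro q
      exact ρ.mem_depth_zero.2 ⟨Polynomial.X * q, by simp⟩
    · rw [map_add]
      exact Submodule.add_mem _ hx hy
    · intro n m x _ hx
      rw [← ρ.e_c]
      exact ρ.e_mem_depth hx
  have he : ∀ n, ∀ x ∈ ρ.depth v n, ∀ i, ρ.e i x ∈ ⨆ n, ρ.depth v n := by
    refine ρ.depth_induction ?_ (fun n x y hx hy i => ?_) (fun n => by simp) ?_
    · intro q i
      rcases lt_trichotomy i 0 with hi | rfl | hi
      · obtain ⟨m, rfl⟩ : ∃ m : ℕ, i = -((m : ℤ) + 1) := ⟨(-i - 1).toNat, by omega⟩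
        exact hneg m _ (Submodule.mem_iSup_of_mem 0 (ρ.mem_depth_zero.2 ⟨q, rfl⟩))
      · rw [e_aeval, ρ.mem_weightSpace.1 hv, map_smul]
        exact Submodule.smul_mem _ _
          (Submodule.mem_iSup_of_mem 0 (ρ.mem_depth_zero.2 ⟨q, rfl⟩))
      · obtain ⟨m, rfl⟩ : ∃ m : ℕ, i = m + 1 := ⟨(i - 1).toNat, by omega⟩
        rw [e_aeval, ρ.e_pos_eq_zero h1 h2, map_zero]
        exact Submodule.zero_mem _
    · rw [map_add]
      exact Submodule.add_mem _ (hx i) (hy i)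
    · intro n m x hx hx' i
      rw [ρ.e_e]
      exact Submodule.add_mem _ (Submodule.add_mem _ (hneg m _ (hx' i))
        (Submodule.smul_mem _ _ (hx' _)))
        (Submodule.smul_mem _ _ (Submodule.mem_iSup_of_mem n (hc n x hx)))
  exact hρ.iSup_eq_top (fun i n x hx => he n x hx i)
    (fun n x hx => Submodule.mem_iSup_of_mem n (hc n x hx))
    (ρ.mem_depth_zero.2 ⟨1, by simp⟩ : v ∈ ρ.depth v 0) hv0

lemma finite_depth_zero {v : M} {p : Polynomial k} (hp : p ≠ 0)
    (hpv : Polynomial.aeval ρ.c p v = 0) : FiniteDimensional k (ρ.depth v 0) := by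
  have hle : ρ.depth v 0 ≤ (Polynomial.degreeLT k p.natDegree).map
      ((LinearMap.applyₗ v) ∘ₗ (Polynomial.aeval (R := k) ρ.c).toLinearMap) := by
    intro x hx
    obtain ⟨q, rfl⟩ := ρ.mem_depth_zero.1 hx
    refine ⟨q % p, ?_, ?_⟩
    · rw [SetLike.mem_coe, Polynomial.mem_degreeLT, ← Polynomial.degree_eq_natDegree hp]
      exact Polynomial.degree_mod_lt q hp
    · conv_rhs => rw [← EuclideanDomain.div_add_mod q p, mul_comm]
      simp [hpv]
  have : FiniteDimensional k (Polynomial.degreeLT k p.natDegree) :=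
    Module.Finite.equiv (Polynomial.degreeLTEquiv k p.natDegree).symm
  exact Submodule.finiteDimensional_of_le hle

lemma finite_depth {v : M} (h0 : FiniteDimensional k (ρ.depth v 0)) (n : ℕ) :
    FiniteDimensional k (ρ.depth v n) := by
  induction n using Nat.strong_induction_on with
  | _ n ih =>
    cases n with
    | zero => exact h0
    | succ n =>
      rw [depth]
      have (i : Fin (n + 1)) := ih (n - i) (by omega)
      infer_instance

lemma IsSimple.finite_of_highest [CharZero k] {ρ : VirasoroRep k M} (hρ : ρ.IsSimple) {v : M}
    {μ : k} (hv : v ∈ ρ.weightSpace μ) (hv0 : v ≠ 0) (h1 : ρ.e 1 v = 0) (h2 : ρ.e 2 v = 0)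
    (lam : k) : FiniteDimensional k (ρ.weightSpace lam) := by
  have hinj : Function.Injective fun n : ℕ => μ - (n : k) := fun m n h => by simpa using h
  have h0 : FiniteDimensional k (ρ.depth v 0) := by
    by_cases hcv : ρ.c v = 0
    · exact ρ.finite_depth_zero (p := Polynomial.X) Polynomial.X_ne_zero (by simpa using hcv)
    have hcv' := ρ.c_mem hv
    have h := ρ.weightSpace_le_of_injective hinj (ρ.depth_le_weightSpace hcv')
      (hρ.iSup_depth hcv' hcv (by rw [ρ.e_c, h1, map_zero]) (by rw [ρ.e_c, h2, map_zero])) 0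
    obtain ⟨q, hq⟩ := ρ.mem_depth_zero.1 (h (by simpa using hv))
    refine ρ.finite_depth_zero (v := v) (p := 1 - q * Polynomial.X) (fun h => ?_) (by simp [hq])
    simpa using congrArg (Polynomial.eval 0) h
  have htop := hρ.iSup_depth hv hv0 h1 h2
  by_cases h : ∃ n : ℕ, μ - (n : k) = lam
  · obtain ⟨n, rfl⟩ := h
    have := ρ.finite_depth h0 n
    exact Submodule.finiteDimensional_of_le
      (ρ.weightSpace_le_of_injective hinj (ρ.depth_le_weightSpace hv) htop n)
  · push Not at h
    rw [ρ.weightSpace_eq_bot (ρ.depth_le_weightSpace hv) htop h]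
    infer_instance

lemma IsSimple.noHighest [CharZero k] {ρ : VirasoroRep k M} (hρ : ρ.IsSimple) {lam : k}
    (h : ¬ FiniteDimensional k (ρ.weightSpace lam)) : ρ.NoHighest := by
  intro μ v hv h1 h2
  by_contra hv0
  exact h (hρ.finite_of_highest (ρ.mem_weightSpace.2 hv) hv0 h1 h2 lam)

end HighestWeight

section Relations

/-- A vector of weight `a - 1` killed by several operators of degree one. -/
structure Adapted (a : k) (y : M) : Prop where
  weight : ρ.e 0 y = (a - 1) • y
  e1 : ρ.e 1 y = 0
  em1_e2 : ρ.e (-1) (ρ.e 2 y) = 0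
  e1_em2_e2 : ρ.e 1 (ρ.e (-2) (ρ.e 2 y)) = 0
  em1_e2_em2_e2 : ρ.e (-1) (ρ.e 2 (ρ.e (-2) (ρ.e 2 y))) = 0

variable {ρ} {a : k} {y : M}

lemma e1_em1_apply (v : M) : ρ.e 1 (ρ.e (-1) v) = ρ.e (-1) (ρ.e 1 v) + (-2 : k) • ρ.e 0 v := by
  have h := ρ.e_e_neg 1 v
  simpa using h

lemma e2_em2_apply [CharZero k] (v : M) : ρ.e 2 (ρ.e (-2) v) =
    ρ.e (-2) (ρ.e 2 v) + (-4 : k) • ρ.e 0 v + (1 / 2 : k) • ρ.c v := by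
  have h := ρ.e_e_neg 2 v
  norm_num at h
  rw [h]
  norm_num

lemma e2_em1_eq_zero (h1 : ρ.e 1 y = 0) (h2 : ρ.e (-1) (ρ.e 2 y) = 0) :
    ρ.e 2 (ρ.e (-1) y) = 0 := by
  rw [ρ.comm 2 (-1) 1 (-3) y, h1, h2]
  simp

lemma e1_em1_eq (h0 : ρ.e 0 y = (a - 1) • y) (h1 : ρ.e 1 y = 0) :
    ρ.e 1 (ρ.e (-1) y) = (-2 * (a - 1)) • y := by
  rw [e1_em1_apply, h0, h1, map_zero]
  module

lemma e3_em1_eq (h0 : ρ.e 0 y = (a - 1) • y) (h1 : ρ.e 1 y = 0) (h2 : ρ.e (-1) (ρ.e 2 y) = 0) :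
    ρ.e 3 (ρ.e (-1) y) = (2 * (a - 1)) • ρ.e 2 y := by
  have h := ρ.comm 1 2 3 1 (ρ.e (-1) y)
  rw [e2_em1_eq_zero h1 h2, e1_em1_eq h0 h1, map_zero, map_smul] at h
  linear_combination (norm := module) -h

lemma em1_e3_eq (h0 : ρ.e 0 y = (a - 1) • y) (h1 : ρ.e 1 y = 0) (h2 : ρ.e (-1) (ρ.e 2 y) = 0) :
    ρ.e (-1) (ρ.e 3 y) = (2 * a + 2) • ρ.e 2 y := by
  rw [ρ.comm (-1) 3 2 4 y, e3_em1_eq h0 h1 h2]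
  module

/-- A vector killed by `e 1` and `e 3` is killed by `e 5`, up to the contribution of `e 2`. -/
lemma e3_e2_eq [CharZero k] {p : M} (h1 : ρ.e 1 p = 0) (h3 : ρ.e 3 p = 0) :
    ρ.e 3 (ρ.e 2 p) = 0 := by
  have h4 := ρ.comm 1 3 4 2 p
  rw [h1, h3, map_zero, map_zero, zero_add] at h4
  have h4 : ρ.e 4 p = 0 := (smul_eq_zero.1 h4.symm).resolve_left two_ne_zero
  have h5 := ρ.comm 1 4 5 3 p
  rw [h1, h4, map_zero, map_zero, zero_add] at h5
  have h5 : ρ.e 5 p = 0 := (smul_eq_zero.1 h5.symm).resolve_left three_ne_zero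
  rw [ρ.comm 3 2 5 (-1) p, h5, h3]
  simp

lemma Adapted.relations [CharZero k] (hρ : ρ.NoHighest) (hy : ρ.Adapted a y) (ha : a ≠ -1) :
    (3 : k) • ρ.e (-1) (ρ.e (-1) y) = (2 * (2 * a - 3)) • ρ.e (-2) y ∧
    (2 * (2 * a - 3)) • ρ.e (-2) (ρ.e 2 y) =
      (18 * (a - 1) + 8 * (2 * a - 3) * (a - 1)) • y - (2 * a - 3) • ρ.c y := by
  obtain ⟨h0, h1, h2, hT1, hT2⟩ := hy
  have e21 := e2_em1_eq_zero h1 h2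
  have e11 := e1_em1_eq h0 h1
  have e31 := e3_em1_eq h0 h1 h2
  have w1 : ρ.e 0 (ρ.e (-1) y) = (a - 2) • ρ.e (-1) y := by
    rw [e_zero_e, h0, map_smul]
    push_cast
    module
  have w2 : ρ.e 0 (ρ.e (-2) y) = (a - 3) • ρ.e (-2) y := by
    rw [e_zero_e, h0, map_smul]
    push_cast
    module
  have wT : ρ.e 0 (ρ.e (-2) (ρ.e 2 y)) = (a - 1) • ρ.e (-2) (ρ.e 2 y) := by
    rw [e_zero_e, e_zero_e, h0]
    simp only [map_smul, map_add]
    push_cast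
    module
  obtain ⟨p, hp⟩ : ∃ p, p = (3 : k) • ρ.e (-1) (ρ.e (-1) y) - (2 * (2 * a - 3)) • ρ.e (-2) y :=
    ⟨_, rfl⟩
  obtain ⟨z, hz⟩ : ∃ z, z = (18 * (a - 1) + 8 * (2 * a - 3) * (a - 1)) • y -
    (2 * a - 3) • ρ.c y - (2 * (2 * a - 3)) • ρ.e (-2) (ρ.e 2 y) := ⟨_, rfl⟩
  have hp0 : ρ.e 0 p = (a - 3) • p := by
    rw [hp]
    simp only [map_sub, map_smul, w2, e_zero_e _ _ (ρ.e (-1) y), w1]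
    push_cast
    module
  have hp1 : ρ.e 1 p = 0 := by
    rw [hp]
    simp only [map_sub, map_smul, e1_em1_apply (ρ.e (-1) y), e11, w1,
      ρ.comm 1 (-2) (-1) (-3) y, h1, map_zero]
    module
  have hp2 : ρ.e 2 p = z := by
    rw [hp, hz]
    simp only [map_sub, map_smul, ρ.comm 2 (-1) 1 (-3) (ρ.e (-1) y), e21, e11, map_zero,
      e2_em2_apply y, h0]
    module
  have hp3 : ρ.e 3 p = 0 := by
    have h3 : ρ.e (-2) (ρ.e 3 y) = 0 := by
      have h12 := ρ.comm 1 2 3 1 y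
      rw [h1, map_zero, zero_add, one_smul] at h12
      have h := ρ.comm 1 (-2) (-1) (-3) (ρ.e 2 y)
      rw [hT1, h2, h12, smul_zero, add_zero] at h
      exact h.symm
    rw [hp]
    simp only [map_sub, map_smul, ρ.comm 3 (-1) 2 (-4) (ρ.e (-1) y), e31, e21, h2,
      ρ.comm 3 (-2) 1 (-5) y, h1, h3]
    simp
  have hz1 : ρ.e 1 z = 0 := by
    rw [hz]
    simp [h1, hT1, ρ.e_c]
  have hz2 : ρ.e (-1) (ρ.e 2 z) = 0 := by
    rw [hz]
    simp [h2, hT2, ρ.e_c]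
  have hz0 : ρ.e 0 z = (a - 1) • z := by
    rw [hz]
    simp only [map_sub, map_smul, ρ.e_c, h0, wT]
    module
  have hz3 : ρ.e 3 z = 0 := hp2 ▸ e3_e2_eq hp1 hp3
  have h := em1_e3_eq hz0 hz1 hz2
  rw [hz3, map_zero] at h
  have ha' : 2 * a + 2 ≠ 0 := fun h => ha (by linear_combination h / 2)
  have hz2' := (smul_eq_zero.1 h.symm).resolve_left ha'
  have hzz : z = 0 := hρ _ z hz0 hz1 hz2'
  have hpp : p = 0 := hρ _ p hp0 hp1 (hp2.trans hzz)
  exact ⟨sub_eq_zero.1 (hp ▸ hpp), (sub_eq_zero.1 (hz ▸ hzz)).symm⟩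

lemma Adapted.e2_ne_zero (hρ : ρ.NoHighest) (hy : ρ.Adapted a y) (hy0 : y ≠ 0) : ρ.e 2 y ≠ 0 :=
  fun h => hy0 (hρ _ y hy.weight hy.e1 h)

lemma Adapted.scalar_relation [CharZero k] (hρ : ρ.NoHighest) (hy : ρ.Adapted a y) (hy0 : y ≠ 0)
    (ha : a ≠ 1) (ha' : a ≠ -1) {t γ : k} (ht : ρ.e (-2) (ρ.e 2 y) = t • y)
    (hγ : ρ.c y = γ • y) : 7 * a - 4 + γ + (3 * a - 4) * t = 0 := by
  have hsq := (hy.relations hρ ha').1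
  have hy2 := hy.e2_ne_zero hρ hy0
  obtain ⟨h0, h1, h2, -, -⟩ := hy
  have e21 := e2_em1_eq_zero h1 h2
  have e11 := e1_em1_eq h0 h1
  have e31 := e3_em1_eq h0 h1 h2
  have w1 : ρ.e 0 (ρ.e (-1) y) = (a - 2) • ρ.e (-1) y := by
    rw [e_zero_e, h0, map_smul]
    push_cast
    module
  obtain ⟨q, hq⟩ : ∃ q, q = (2 : k) • ρ.e (-2) (ρ.e (-1) y) - (3 * a - 4) • ρ.e (-3) y :=
    ⟨_, rfl⟩
  obtain ⟨s, hs⟩ : ∃ s, s = 7 * a - 4 + γ + (3 * a - 4) * t := ⟨_, rfl⟩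
  have hq1 : ρ.e 1 q = 0 := by
    rw [hq]
    simp only [map_sub, map_smul, ρ.comm 1 (-2) (-1) (-3) (ρ.e (-1) y), e11,
      ρ.comm 1 (-3) (-2) (-4) y, h1, map_zero]
    linear_combination (norm := module) (-2 : k) • hsq
  have hm3 : ρ.e (-3) (ρ.e 2 y) = (-t) • ρ.e (-1) y := by
    have h := ρ.comm (-2) (-1) (-3) 1 (ρ.e 2 y)
    rw [h2, ht, map_zero, map_smul] at h
    linear_combination (norm := module) -h
  have hq2 : ρ.e 2 q = s • ρ.e (-1) y := by
    rw [hq, hs]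
    simp only [map_sub, map_smul, e2_em2_apply (ρ.e (-1) y), e21, w1, ← ρ.e_c, hγ, map_zero,
      ρ.comm 2 (-3) (-1) (-5) y, hm3]
    module
  have hq3 : ρ.e 3 q = (s * (-2 * (a - 1))) • y := by
    have h := ρ.comm 1 2 3 1 q
    rw [hq1, hq2, map_zero, map_smul, e11] at h
    linear_combination (norm := module) -h
  have hq4 : ρ.e 4 q = 0 := by
    have h := ρ.comm 1 3 4 2 q
    rw [hq1, hq3, map_zero, map_smul, h1, smul_zero, zero_add] at h
    exact (smul_eq_zero.1 h.symm).resolve_left two_ne_zero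
  have hq5 : ρ.e 5 q = 0 := by
    have h := ρ.comm 1 4 5 3 q
    rw [hq1, hq4, map_zero, map_zero, zero_add] at h
    exact (smul_eq_zero.1 h.symm).resolve_left three_ne_zero
  have h : (s * (-4 * (a - 1))) • ρ.e 2 y = 0 := by
    have h := ρ.comm 2 3 5 1 q
    rw [hq5, hq3, hq2] at h
    simp only [map_smul, e31] at h
    linear_combination (norm := module) h
  rw [← hs]
  have h4 : -4 * (a - 1) ≠ 0 := mul_ne_zero (by norm_num) (sub_ne_zero.2 ha)
  exact (mul_eq_zero.1 ((smul_eq_zero.1 h).resolve_right hy2)).resolve_right h4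

lemma Adapted.ne_one [CharZero k] (hρ : ρ.NoHighest) (hρ' : ρ.twist.NoHighest)
    (hy : ρ.Adapted a y) (hy0 : y ≠ 0) : a ≠ 1 := by
  rintro rfl
  have h1 : ρ.e (-1) y = 0 := by
    refine hρ (-1) _ ?_ ?_ (e2_em1_eq_zero hy.e1 hy.em1_e2)
    · rw [e_zero_e, hy.weight]
      simp
    · rw [e1_em1_eq hy.weight hy.e1]
      simp
  have h2 : ρ.e (-2) y = 0 := by
    have h := (hy.relations hρ (by norm_num)).1
    rw [h1, map_zero, smul_zero] at h
    exact (smul_eq_zero.1 h.symm).resolve_left (by norm_num)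
  refine hy0 (hρ' 0 y ?_ (by simpa using h1) (by simpa using h2))
  simp [hy.weight]

lemma Adapted.ne_three_halves [CharZero k] (hρ : ρ.NoHighest) (hy : ρ.Adapted a y)
    (hy0 : y ≠ 0) : 2 * a - 3 ≠ 0 := by
  intro ha
  have ha' : a = 3 / 2 := by linear_combination ha / 2
  have h := (hy.relations hρ (by rw [ha']; norm_num)).2
  rw [ha, ha'] at h
  norm_num at h
  exact hy0 (by simpa using h.symm)

lemma Adapted.twist (hy : ρ.Adapted a y)
    (h : ρ.e 1 (ρ.e (-2) (ρ.e 2 (ρ.e (-2) (ρ.e 2 y)))) = 0) :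
    ρ.twist.Adapted (-a) (ρ.e 2 y) where
  weight := by
    simp only [twist_e, neg_zero, e_zero_e, hy.weight, map_smul]
    push_cast
    module
  e1 := by simp [hy.em1_e2]
  em1_e2 := by simp [hy.e1_em2_e2]
  e1_em2_e2 := by simp [hy.em1_e2_em2_e2]
  em1_e2_em2_e2 := by simp [h]

lemma Adapted.intermediate [CharZero k] (hρ : ρ.NoHighest) (hρ' : ρ.twist.NoHighest)
    (hy : ρ.Adapted a y) (hy0 : y ≠ 0)
    (h : ρ.e 1 (ρ.e (-2) (ρ.e 2 (ρ.e (-2) (ρ.e 2 y)))) = 0) :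
    a = 0 ∧ ρ.c y = 0 ∧ ρ.e (-1) (ρ.e (-1) y) = (-2 : k) • ρ.e (-2) y ∧
      ρ.e 2 (ρ.e (-2) y) = (3 : k) • y := by
  have hx := hy.twist h
  have hx0 := hy.e2_ne_zero hρ hy0
  have hyy : ρ.twist.twist.NoHighest := by
    intro μ v h0 h1 h2
    exact hρ μ v (by simpa using h0) (by simpa using h1) (by simpa using h2)
  have ha1 := hy.ne_one hρ hρ' hy0
  have ha1' : a ≠ -1 := fun h => hx.ne_one hρ' hyy hx0 (by rw [h, neg_neg])
  have ha3 := hy.ne_three_halves hρ hy0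
  have ha3' := hx.ne_three_halves hρ' hx0
  have hneg : -a ≠ -1 := fun h => ha1 (neg_injective h)
  obtain ⟨hsq, hT⟩ := hy.relations hρ ha1'
  have hT' := (hx.relations hρ' hneg).2
  simp only [twist_e, twist_c, neg_neg, map_neg, ← ρ.e_c] at hT'
  have hT2 : (2 * (2 * -a - 3)) • ρ.e (-2) (ρ.e 2 y) =
      (18 * (-a - 1) + 8 * (2 * -a - 3) * (-a - 1)) • y + (2 * -a - 3) • ρ.c y := by
    rw [← sub_eq_zero]
    refine hρ (a - 1) _ ?_ ?_ ?_
    · have wT : ρ.e 0 (ρ.e (-2) (ρ.e 2 y)) = (a - 1) • ρ.e (-2) (ρ.e 2 y) := by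
        rw [e_zero_e, e_zero_e, hy.weight]
        simp only [map_smul, map_add]
        push_cast
        module
      simp only [map_sub, map_add, map_smul, ρ.e_c, hy.weight, wT]
      module
    · simp [ρ.e_c, hy.e1, hy.e1_em2_e2]
    · simp only [map_sub, map_add, map_smul]
      linear_combination (norm := module) hT'
  obtain ⟨γ, hγ⟩ : ∃ γ : k, ρ.c y = γ • y := by
    refine ⟨(2 * (2 * a - 3) * (2 * -a - 3))⁻¹ * ((2 * -a - 3) *
      (18 * (a - 1) + 8 * (2 * a - 3) * (a - 1)) - (2 * a - 3) *
      (18 * (-a - 1) + 8 * (2 * -a - 3) * (-a - 1))), ?_⟩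
    rw [mul_smul, eq_inv_smul_iff₀ (mul_ne_zero (mul_ne_zero two_ne_zero ha3) ha3')]
    linear_combination (norm := module) (2 * -a - 3) • hT - (2 * a - 3) • hT2
  obtain ⟨t, ht⟩ : ∃ t : k, ρ.e (-2) (ρ.e 2 y) = t • y := by
    refine ⟨(2 * (2 * a - 3))⁻¹ * (18 * (a - 1) + 8 * (2 * a - 3) * (a - 1) -
      (2 * a - 3) * γ), ?_⟩
    rw [mul_smul, eq_inv_smul_iff₀ (mul_ne_zero two_ne_zero ha3), hT, hγ]
    module
  have r1 := hy.scalar_relation hρ hy0 ha1 ha1' ht hγ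
  have r2 := hx.scalar_relation hρ' hx0 (t := t) (γ := -γ)
    (fun h => ha1' (by rw [← h, neg_neg])) hneg (by simp [ht]) (by simp [← ρ.e_c, hγ])
  have ht1 : t = -1 := by linear_combination (-1 / 8) * (r1 + r2)
  have hγa : γ = -4 * a := by linear_combination (1 / 2) * (r1 - r2) - 3 * a * ht1
  rw [ht, hγ, ht1, hγa] at hT hT2
  have s1 : a * (4 * a - 5) = 0 := by
    have : (a * (4 * a - 5)) • y = 0 := by
      linear_combination (norm := module) (-1 / 6 : k) • hT
    exact (smul_eq_zero.1 this).resolve_right hy0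
  have s2 : a * (4 * a + 5) = 0 := by
    have : (a * (4 * a + 5)) • y = 0 := by
      linear_combination (norm := module) (-1 / 6 : k) • hT2
    exact (smul_eq_zero.1 this).resolve_right hy0
  have ha : a = 0 := by linear_combination (s2 - s1) / 10
  subst ha
  have hc : ρ.c y = 0 := by rw [hγ, hγa]; simp
  refine ⟨rfl, hc, ?_, ?_⟩
  · linear_combination (norm := module) (1 / 3 : k) • hsq
  · rw [e2_em2_apply, ht, ht1, hc, hy.weight]
    module

end Relations

section IntermediateSeries

variable {ρ} {y : M}

lemma em1_e_nat [CharZero k] (h0 : ρ.e 0 y = -y) (h1 : ρ.e 1 y = 0)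
    (h2 : ρ.e (-1) (ρ.e 2 y) = 0) (n : ℕ) :
    ρ.e (-1) (ρ.e (n + 2) y) = (n + 1 : k) • ρ.e (n + 1) y := by
  induction n with
  | zero => simpa [h1] using h2
  | succ n ih =>
    rcases Nat.eq_zero_or_pos n with rfl | hn
    · have h0' : ρ.e 0 y = ((0 : k) - 1) • y := by rw [h0]; module
      have := em1_e3_eq h0' h1 h2
      norm_num at this ⊢
      exact this
    · have h3 := ρ.comm 1 (n + 2) (n + 3) (n + 1) y (by ring) (by omega) (by push_cast; ring)
      have h4 := ρ.comm 1 (n + 1) (n + 2) n y (by ring) (by omega) (by push_cast; ring)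
      have h5 := e1_em1_apply (ρ := ρ) (ρ.e (n + 2) y)
      rw [h1, map_zero, zero_add] at h3 h4
      rw [ih, h3, e_zero_e, h0, map_smul, map_smul, h4] at h5
      push_cast at h5 ⊢
      rw [show (n : ℤ) + 1 + 2 = n + 3 by ring, show (n : ℤ) + 1 + 1 = n + 2 by ring]
      have hn' : (n + 1 : k) ≠ 0 := by exact_mod_cast n.succ_ne_zero
      refine smul_right_injective M hn' ?_
      simp only [map_neg] at h5
      linear_combination (norm := module) -h5

lemma comm_of_c_eq_zero {v : M} (hv : ρ.c v = 0) (i j n : ℤ) (h : i + j = n) :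
    ρ.e i (ρ.e j v) = ρ.e j (ρ.e i v) + ((j : k) - i) • ρ.e n v := by
  rw [ρ.e_e, hv, smul_zero, add_zero, h]

lemma c_e_eq_zero (hc : ρ.c y = 0) (j : ℤ) : ρ.c (ρ.e j y) = 0 := by
  rw [← ρ.e_c, hc, map_zero]

lemma e1_e_eq (hc : ρ.c y = 0) (h1 : ρ.e 1 y = 0) (j n : ℤ) (h : 1 + j = n) :
    ρ.e 1 (ρ.e j y) = (j - 1 : k) • ρ.e n y := by
  rw [comm_of_c_eq_zero hc 1 j n h, h1, map_zero, zero_add, Int.cast_one]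

lemma em1_e_step [CharZero k] (hρ : ρ.NoHighest) (hc : ρ.c y = 0) (h0 : ρ.e 0 y = -y)
    (h1 : ρ.e 1 y = 0) (h2 : ρ.e (-1) (ρ.e 2 y) = 0) {j : ℤ} (hj : j ≠ -1)
    (z1 : ρ.e (-1) (ρ.e (j + 1) y) = (j : k) • ρ.e j y)
    (z2 : ρ.e (-1) (ρ.e (j + 2) y) = (j + 1 : k) • ρ.e (j + 1) y)
    (d : ρ.e 2 (ρ.e j y) = (j - 1 : k) • ρ.e (j + 2) y) :
    ρ.e (-1) (ρ.e j y) = (j - 1 : k) • ρ.e (j - 1) y ∧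
    ρ.e 2 (ρ.e (j - 1) y) = (j - 2 : k) • ρ.e (j + 1) y := by
  have hj' : (j + 1 : k) ≠ 0 := by exact_mod_cast (by omega : j + 1 ≠ 0)
  have hd : ρ.e 2 (ρ.e (j - 1) y) = (j - 2 : k) • ρ.e (j + 1) y := by
    have k1 := comm_of_c_eq_zero hc 2 j (j + 2) (by ring)
    have k2 := comm_of_c_eq_zero (c_e_eq_zero hc 2) (-1) j (j - 1) (by ring)
    have k3 := comm_of_c_eq_zero hc 2 (j - 1) (j + 1) (by ring)
    have k4 : ρ.e j (ρ.e 2 y) = ρ.e (j + 2) y := by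
      push_cast at k1
      linear_combination (norm := module) d - k1
    rw [k4, z2, h2, map_zero, zero_add] at k2
    push_cast at k2 k3
    have k5 : ρ.e (j - 1) (ρ.e 2 y) = ρ.e (j + 1) y := by
      refine smul_right_injective M hj' ?_
      linear_combination (norm := module) -k2
    rw [k3, k5]
    module
  refine ⟨sub_eq_zero.1 (hρ (j - 2) _ ?_ ?_ ?_), hd⟩
  · simp only [map_sub, map_smul, e_zero_e, h0, map_add, map_neg]
    push_cast
    module
  · rw [map_sub, map_smul, e1_em1_apply, e1_e_eq hc h1 j (j + 1) (by ring),
      e1_e_eq hc h1 (j - 1) j (by ring), map_smul, z1, e_zero_e, h0, map_neg]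
    push_cast
    module
  · rw [map_sub, map_smul, ρ.comm 2 (-1) 1 (-3), hd, d, map_smul, z2,
      e1_e_eq hc h1 j (j + 1) (by ring)]
    module

lemma em1_e_neg_nat [CharZero k] (hρ : ρ.NoHighest) (hc : ρ.c y = 0) (h0 : ρ.e 0 y = -y)
    (h1 : ρ.e 1 y = 0) (h2 : ρ.e (-1) (ρ.e 2 y) = 0)
    (hm : ρ.e (-1) (ρ.e (-1) y) = (-2 : k) • ρ.e (-2) y) (hT : ρ.e 2 (ρ.e (-2) y) = (3 : k) • y)
    (n : ℕ) (j : ℤ) (hj : j = -n) :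
    ρ.e (-1) (ρ.e j y) = (j - 1 : k) • ρ.e (j - 1) y ∧
    ρ.e (-1) (ρ.e (j - 1) y) = (j - 2 : k) • ρ.e (j - 2) y ∧
    ρ.e 2 (ρ.e (j - 2) y) = (j - 3 : k) • ρ.e j y := by
  induction n generalizing j with
  | zero =>
    obtain rfl : j = 0 := by simpa using hj
    refine ⟨?_, ?_, ?_⟩
    · rw [h0]
      simp
    · simpa using hm
    · simp only [zero_sub, hT, h0, Int.cast_zero]
      module
  | succ n ih =>
    obtain ⟨z2, z1, d⟩ := ih (j + 1) (by rw [hj]; push_cast; ring)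
    obtain ⟨i, rfl⟩ : ∃ i, j = i + 1 := ⟨j - 1, by ring⟩
    have a1 : i + 1 + 1 = i + 2 := by ring
    have a2 : i + 2 - 1 = i + 1 := by ring
    have a3 : i + 1 - 2 = i - 1 := by ring
    simp only [a1, a2, a3, add_sub_cancel_right] at z1 z2 d ⊢
    push_cast at z1 z2 d ⊢
    have z1' : ρ.e (-1) (ρ.e (i + 1) y) = (i : k) • ρ.e i y := by
      rw [z1]
      module
    have z2' : ρ.e (-1) (ρ.e (i + 2) y) = (i + 1 : k) • ρ.e (i + 1) y := by
      rw [z2]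
      module
    have d' : ρ.e 2 (ρ.e i y) = (i - 1 : k) • ρ.e (i + 2) y := by
      rw [d]
      module
    obtain ⟨r1, r2⟩ := em1_e_step hρ hc h0 h1 h2 (by omega) z1' z2' d'
    refine ⟨?_, ?_, ?_⟩
    · rw [z1']
      module
    · rw [r1]
      module
    · rw [r2]
      module

lemma em1_e_eq [CharZero k] (hρ : ρ.NoHighest) (hc : ρ.c y = 0) (h0 : ρ.e 0 y = -y)
    (h1 : ρ.e 1 y = 0) (h2 : ρ.e (-1) (ρ.e 2 y) = 0)
    (hm : ρ.e (-1) (ρ.e (-1) y) = (-2 : k) • ρ.e (-2) y) (hT : ρ.e 2 (ρ.e (-2) y) = (3 : k) • y)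
    (j : ℤ) : ρ.e (-1) (ρ.e j y) = (j - 1 : k) • ρ.e (j - 1) y := by
  rcases le_or_gt j 0 with hj | hj
  · exact (em1_e_neg_nat hρ hc h0 h1 h2 hm hT (-j).toNat j (by omega)).1
  · rcases eq_or_ne j 1 with rfl | hj1
    · simp [h1]
    · obtain ⟨n, rfl⟩ : ∃ n : ℕ, j = n + 2 := ⟨(j - 2).toNat, by omega⟩
      rw [em1_e_nat h0 h1 h2 n, show (n : ℤ) + 2 - 1 = n + 1 by ring]
      push_cast
      module

/-- The vectors `e j y` span a module of the intermediate series. -/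
lemma e_e_eq [CharZero k] (hc : ρ.c y = 0)
    (h : ∀ j : ℤ, ρ.e (-1) (ρ.e j y) = (j - 1 : k) • ρ.e (j - 1) y) (i : ℤ) :
    ∀ j : ℤ, ρ.e i (ρ.e j y) = (j - 1 : k) • ρ.e (i + j) y := by
  have key : ∀ i j : ℤ, ρ.e (i - 1) (ρ.e j y) - (j - 1 : k) • ρ.e (i + j - 1) y =
      ρ.e i (ρ.e (j - 1) y) - (j - 2 : k) • ρ.e (i + j - 1) y := by
    intro i j
    have k1 := comm_of_c_eq_zero (c_e_eq_zero hc j) (-1) i (i - 1) (by ring)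
    have k2 := comm_of_c_eq_zero (c_e_eq_zero hc i) (-1) j (j - 1) (by ring)
    have k3 := comm_of_c_eq_zero hc i j (i + j) rfl
    have k4 := comm_of_c_eq_zero hc j (i - 1) (i + j - 1) (by ring)
    have k5 := comm_of_c_eq_zero hc (j - 1) i (i + j - 1) (by ring)
    rw [h j, k3, map_add, k2, map_smul, map_smul, h (i + j), h i, map_smul, k4, k5] at k1
    push_cast at k1
    refine smul_right_injective M (two_ne_zero (α := k)) ?_
    linear_combination (norm := module) -k1
  induction i using Int.inductionOn' (b := -1) with
  | zero =>
    intro j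
    rw [h j, show -1 + j = j - 1 by ring]
  | succ i _ ih =>
    intro j
    have h1 := key (i + 1) (j + 1)
    simp only [add_sub_cancel_right, ih, show i + 1 + (j + 1) - 1 = i + 1 + j by ring,
      show i + (j + 1) = i + 1 + j by ring, sub_self] at h1
    push_cast at h1
    linear_combination (norm := module) -h1
  | pred i _ ih =>
    intro j
    have h1 := key i j
    simp only [ih, show i + (j - 1) = i + j - 1 by ring, show i - 1 + j = i + j - 1 by ring] at h1 ⊢
    push_cast at h1
    linear_combination (norm := module) h1

lemma IsSimple.finite_of_e_e_eq [CharZero k] (hρ : ρ.IsSimple) (hy0 : y ≠ 0) (hc : ρ.c y = 0)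
    (h0 : ρ.e 0 y = -y) (h : ∀ i j : ℤ, ρ.e i (ρ.e j y) = (j - 1 : k) • ρ.e (i + j) y) :
    FiniteDimensional k (ρ.weightSpace (-1)) := by
  have htop : ⨆ n : ℤ, k ∙ ρ.e n y = ⊤ := by
    refine hρ.iSup_eq_top (n := (0 : ℤ)) (v := y) (fun i n v hv => ?_) (fun n v hv => ?_) ?_ hy0
    · obtain ⟨r, rfl⟩ := Submodule.mem_span_singleton.1 hv
      rw [map_smul, h]
      exact Submodule.smul_mem _ _ (Submodule.smul_mem _ _
        (Submodule.mem_iSup_of_mem (i + n) (Submodule.mem_span_singleton_self _)))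
    · obtain ⟨r, rfl⟩ := Submodule.mem_span_singleton.1 hv
      simp [c_e_eq_zero hc]
    · rw [h0, Submodule.mem_span_singleton]
      exact ⟨-1, by simp⟩
  have hle := ρ.weightSpace_le_of_injective (S := fun n : ℤ => k ∙ ρ.e n y)
    (ν := fun n : ℤ => (n - 1 : k)) (fun m n hmn => by simpa using hmn) (fun n => ?_) htop 0
  · simp only [Int.cast_zero, zero_sub] at hle
    exact Submodule.finiteDimensional_of_le hle
  · rw [Submodule.span_singleton_le_iff_mem, mem_weightSpace, h]
    simp only [zero_add]

end IntermediateSeries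

section AdjacentWeights

variable {ρ}

lemma exists_adapted {a : k} (h : ¬ FiniteDimensional k (ρ.weightSpace (a - 1)))
    (hfin : FiniteDimensional k (ρ.weightSpace a)) :
    ∃ y ≠ 0, ρ.Adapted a y ∧ ρ.e 1 (ρ.e (-2) (ρ.e 2 (ρ.e (-2) (ρ.e 2 y)))) = 0 := by
  have h1 : ∀ v ∈ ρ.weightSpace (a - 1), ρ.e 1 v ∈ ρ.weightSpace a :=
    fun v hv => ρ.e_mem (by simp) hv
  have hT : ∀ v ∈ ρ.weightSpace (a - 1), (ρ.e (-2) ∘ₗ ρ.e 2) v ∈ ρ.weightSpace (a - 1) :=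
    fun v hv => ρ.e_mem (μ := a + 1) (by push_cast; ring) (ρ.e_mem (by push_cast; ring) hv)
  have h2 : ∀ v ∈ ρ.weightSpace (a - 1), (ρ.e (-1) ∘ₗ ρ.e 2) v ∈ ρ.weightSpace a :=
    fun v hv => ρ.e_mem (μ := a + 1) (by push_cast; ring) (ρ.e_mem (by push_cast; ring) hv)
  let f1 := (ρ.e 1).restrict h1
  let f2 := (ρ.e (-1) ∘ₗ ρ.e 2).restrict h2
  let T := (ρ.e (-2) ∘ₗ ρ.e 2).restrict hT
  let F := f1.prod (f2.prod ((f1 ∘ₗ T).prod ((f2 ∘ₗ T).prod (f1 ∘ₗ T ∘ₗ T))))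
  have hF : ¬ Function.Injective F := fun hF => h (Module.Finite.of_injective F hF)
  rw [injective_iff_map_eq_zero] at hF
  push Not at hF
  obtain ⟨⟨y, hy⟩, hFy, hy0⟩ := hF
  simp only [F, LinearMap.prod_apply, Function.prod, Prod.mk_eq_zero] at hFy
  obtain ⟨r1, r2, r3, r4, r5⟩ := hFy
  refine ⟨y, fun h => hy0 (Subtype.ext h), ⟨ρ.mem_weightSpace.1 hy, ?_, ?_, ?_, ?_⟩, ?_⟩
  · exact congrArg Subtype.val r1
  · exact congrArg Subtype.val r2
  · exact congrArg Subtype.val r3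
  · exact congrArg Subtype.val r4
  · exact congrArg Subtype.val r5

/-- A weight space above an infinite-dimensional one is infinite-dimensional. -/
lemma IsSimple.infinite_succ [CharZero k] (hρ : ρ.IsSimple) {b : k}
    (h : ¬ FiniteDimensional k (ρ.weightSpace b)) :
    ¬ FiniteDimensional k (ρ.weightSpace (b + 1)) := by
  intro hfin
  obtain ⟨a, rfl⟩ : ∃ a, b = a - 1 := ⟨b + 1, by ring⟩
  rw [sub_add_cancel] at hfin
  have hh := hρ.noHighest h
  have hl : ρ.twist.NoHighest := hρ.twist.noHighest (lam := -(a - 1)) (by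
    rwa [weightSpace_twist, neg_neg])
  obtain ⟨y, hy0, hy, hy'⟩ := exists_adapted h hfin
  obtain ⟨rfl, hc, hm, hT⟩ := hy.intermediate hh hl hy0 hy'
  have h0 : ρ.e 0 y = -y := by
    rw [hy.weight]
    simp
  refine h ?_
  rw [zero_sub]
  exact hρ.finite_of_e_e_eq hy0 hc h0
    (e_e_eq hc (em1_e_eq hh hc h0 hy.e1 hy.em1_e2 hm hT))

lemma IsSimple.infinite_pred [CharZero k] (hρ : ρ.IsSimple) {b : k}
    (h : ¬ FiniteDimensional k (ρ.weightSpace b)) :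
    ¬ FiniteDimensional k (ρ.weightSpace (b - 1)) := by
  have := hρ.twist.infinite_succ (b := -b) (by rwa [weightSpace_twist, neg_neg])
  rwa [weightSpace_twist, neg_add, neg_neg, ← sub_eq_add_neg] at this

lemma IsSimple.infinite_add_int [CharZero k] (hρ : ρ.IsSimple) {b : k}
    (h : ¬ FiniteDimensional k (ρ.weightSpace b)) (n : ℤ) :
    ¬ FiniteDimensional k (ρ.weightSpace (b + n)) := by
  induction n using Int.induction_on with
  | zero => rwa [Int.cast_zero, add_zero]
  | succ n ih =>
    have := hρ.infinite_succ ih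
    rwa [add_assoc, ← Int.cast_one, ← Int.cast_add] at this
  | pred n ih =>
    have := hρ.infinite_pred ih
    rwa [add_sub_assoc, ← Int.cast_one, ← Int.cast_sub] at this

end AdjacentWeights

section OfLieModule

variable {L : Type*} [LieRing L] [LieAlgebra k L] [LieRingModule L M] [LieModule k L M]

/-- The action on a Lie module of a Lie algebra with a family satisfying the Virasoro
relations. -/
def ofLieModule (E : ℤ → L) (C : L) (hC : ∀ z : L, ⁅C, z⁆ = 0)
    (hE : ∀ i j : ℤ, ⁅E i, E j⁆ = (j - i) • E (i + j) +
      (if i + j = 0 then ((i : k) ^ 3 - (i : k)) / 12 else 0) • C) : VirasoroRep k M where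
  e i := LieModule.toEnd k L M (E i)
  c := LieModule.toEnd k L M C
  e_c i v := by
    have h := lie_lie C (E i) v
    rw [hC, zero_lie] at h
    simpa using (sub_eq_zero.1 h.symm).symm
  e_e i j v := by
    have h := lie_lie (E i) (E j) v
    rw [hE, add_lie, smul_lie, smul_lie, ← Int.cast_smul_eq_zsmul k] at h
    simp only [LieModule.toEnd_apply_apply]
    push_cast at h
    linear_combination (norm := module) -h

end OfLieModule

end VirasoroRep


/-- Main theorem: let `M` be a simple weight module over the Virasoro algebra.
If some weight space `M_λ` is infinite-dimensional, then
`supp(M) = λ + ℤ` and every weight space `M_{λ+k}`, `k ∈ ℤ`, is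
infinite-dimensional. -/
theorem virasoro_infinite_weight_space_forces_all_infinite
    {k : Type*} [Field k] [CharZero k] [IsAlgClosed k]
    {L : Type*} [LieRing L] [LieAlgebra k L]
    (E : ℤ → L) (C : L)
    (hC : ∀ z : L, ⁅C, z⁆ = 0)
    (hE : ∀ i j : ℤ, ⁅E i, E j⁆ =
      (j - i) • E (i + j) + (if i + j = 0 then ((i : k) ^ 3 - (i : k)) / 12 else 0) • C)
    (hspan : Submodule.span k ({C} ∪ Set.range E) = ⊤)
    {M : Type*} [AddCommGroup M] [Module k M] [LieRingModule L M] [LieModule k L M]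
    [LieModule.IsIrreducible k L M]
    (hweight : (⨆ μ : k, Module.End.eigenspace (LieModule.toEnd k L M (E 0)) μ) = ⊤)
    (lam : k)
    (hinf : ¬ FiniteDimensional k
      ↥(Module.End.eigenspace (LieModule.toEnd k L M (E 0)) lam)) :
    (∀ μ : k, Module.End.eigenspace (LieModule.toEnd k L M (E 0)) μ ≠ ⊥ ↔
      ∃ n : ℤ, μ = lam + n) ∧
    (∀ n : ℤ, ¬ FiniteDimensional k
      ↥(Module.End.eigenspace (LieModule.toEnd k L M (E 0)) (lam + n))) := by
  let ρ : VirasoroRep k M := VirasoroRep.ofLieModule E C hC hE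
  have hρ : ρ.IsSimple := by
    intro N hN hc
    have hmem : ∀ x : L, ∀ v ∈ N, ⁅x, v⁆ ∈ N := by
      intro x v hv
      have hx : x ∈ Submodule.span k ({C} ∪ Set.range E) := hspan ▸ trivial
      induction hx using Submodule.span_induction with
      | mem x hx =>
        rcases hx with rfl | ⟨i, rfl⟩
        · exact hc v hv
        · exact hN i v hv
      | zero => simp
      | add x y _ _ hx hy => simpa using N.add_mem hx hy
      | smul r x _ hx => simpa using N.smul_mem r hx
    let N' : LieSubmodule k L M := { N with lie_mem := fun {x v} hv => hmem x v hv }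
    rcases eq_bot_or_eq_top N' with h | h
    · exact Or.inl (by simpa [N'] using congrArg LieSubmodule.toSubmodule h)
    · exact Or.inr (by simpa [N'] using congrArg LieSubmodule.toSubmodule h)
  have hall : ∀ n : ℤ, ¬ FiniteDimensional k (ρ.weightSpace (lam + n)) :=
    hρ.infinite_add_int hinf
  have hne : ∀ {μ : k}, ¬ FiniteDimensional k (ρ.weightSpace μ) → ρ.weightSpace μ ≠ ⊥ := by
    intro μ h hbot
    rw [hbot] at h
    exact h inferInstance
  refine ⟨fun μ => ⟨fun hμ => ?_, ?_⟩, hall⟩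
  · by_contra! h
    exact hμ (ρ.weightSpace_eq_bot (S := fun n : ℤ => ρ.weightSpace (lam + n))
      (fun _ => le_rfl) (hρ.iSup_weightSpace (hne hinf)) fun n => (h n).symm)
  · rintro ⟨n, rfl⟩
    exact hne (hall n)
end

section
/- Let M be a simple weight module over the Virasoro algebra such that some weight space M_λ satisfies 0 < dim M_λ < ∞. Then all weight spaces of M are finite-dimensional, i.e., M is a Harish-Chandra module. -/
/-- The endomorphisms `e i` satisfy the Virasoro relations with central charge `γ`. -/
structure VirasoroAction {k M : Type*} [Field k] [AddCommGroup M] [Module k M]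
    (e : ℤ → Module.End k M) (γ : k) : Prop where
  bracket : ∀ (i j : ℤ) (x : M), e i (e j x) = e j (e i x) + ((j : k) - i) • e (i + j) x +
    (if i + j = 0 then ((i : k) ^ 3 - i) / 12 * γ else 0) • x

/-- There is no nonzero weight vector annihilated by `e 1` and `e 2`. -/
def NoSingularVector {k M : Type*} [Field k] [AddCommGroup M] [Module k M]
    (e : ℤ → Module.End k M) : Prop :=
  ∀ (ξ : k) (x : M), e 0 x = ξ • x → e 1 x = 0 → e 2 x = 0 → x = 0

/-- A subspace stable under `e 1`, `e (-1)`, `e 2`, `e (-2)` is trivial. -/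
def IrreducibleAction {k M : Type*} [Field k] [AddCommGroup M] [Module k M]
    (e : ℤ → Module.End k M) : Prop :=
  ∀ N : Submodule k M, (∀ x ∈ N, e 1 x ∈ N ∧ e (-1) x ∈ N ∧ e 2 x ∈ N ∧ e (-2) x ∈ N) →
    N = ⊥ ∨ N = ⊤

section LinearAlgebra

variable {k M : Type*} [Field k] [AddCommGroup M] [Module k M]

theorem eigenspace_le_of_iSup_eq_top_s18 {ι : Type*} (T : Module.End k M) (A : ι → Submodule k M)
    (f : ι → k) (hA : ∀ i, A i ≤ T.eigenspace (f i)) (htop : ⨆ i, A i = ⊤) (ξ : k) :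
    T.eigenspace ξ ≤ ⨆ (i) (_ : f i = ξ), A i := by
  have hind := T.eigenspaces_iSupIndep ξ
  set B := ⨆ (i) (_ : f i = ξ), A i with hB
  set R := ⨆ (η) (_ : η ≠ ξ), T.eigenspace η with hR
  have hBE : B ≤ T.eigenspace ξ := iSup₂_le fun i hi => hi ▸ hA i
  have hsup : B ⊔ R = ⊤ := by
    rw [eq_top_iff, ← htop]
    refine iSup_le fun i => ?_
    by_cases hi : f i = ξ
    · exact le_sup_of_le_left (le_iSup₂_of_le i hi le_rfl)
    · exact le_sup_of_le_right (le_iSup₂_of_le (f i) hi (hA i))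
  intro x hx
  have hx' : x ∈ B ⊔ R := hsup ▸ Submodule.mem_top
  obtain ⟨b, hb, r, hr, rfl⟩ := Submodule.mem_sup.1 hx'
  have hr' : r ∈ T.eigenspace ξ := by
    have := Submodule.sub_mem _ hx (hBE hb)
    simpa using this
  have : r = 0 := by
    have := hind.le_bot (show r ∈ T.eigenspace ξ ⊓ R from ⟨hr', hr⟩)
    simpa using this
  simpa [this] using hb

theorem Submodule.not_fg_inf_ker {X Y : Submodule k M} (hX : ¬ X.FG) (hY : Y.FG)
    (f : Module.End k M) (h : ∀ x ∈ X, f x ∈ Y) : ¬ (X ⊓ LinearMap.ker f).FG := by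
  intro hK
  refine hX (Submodule.fg_of_fg_map_of_fg_inf_ker f ?_ hK)
  have : X.map f ≤ Y := by
    rintro _ ⟨x, hx, rfl⟩
    exact h x hx
  exact Submodule.FG.of_le hY this

theorem Submodule.exists_ne_zero_of_not_fg {X : Submodule k M} (hX : ¬ X.FG) :
    ∃ x ∈ X, x ≠ 0 := by
  by_contra! h
  exact hX (((Submodule.eq_bot_iff X).2 h) ▸ Submodule.fg_bot)

end LinearAlgebra

namespace VirasoroAction

variable {k M : Type*} [Field k] [AddCommGroup M] [Module k M]
  {e : ℤ → Module.End k M} {γ : k}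

theorem mirror (h : VirasoroAction e γ) : VirasoroAction (fun i => -e (-i)) (-γ) where
  bracket i j x := by
    have := h.bracket (-i) (-j) x
    have h1 : -(i + j) = -i + -j := by ring
    have h2 : (-i + -j = 0) ↔ i + j = 0 := by omega
    simp only [LinearMap.neg_apply, map_neg, neg_neg, h1, this, h2]
    push_cast
    split_ifs <;> module

theorem bracket_of_add_ne_zero (h : VirasoroAction e γ) {i j : ℤ} (hij : i + j ≠ 0) (x : M) :
    e i (e j x) = e j (e i x) + ((j : k) - i) • e (i + j) x := by
  simpa [hij] using h.bracket i j x

theorem weight_shift (h : VirasoroAction e γ) {ξ : k} {x : M} (hx : e 0 x = ξ • x) (i : ℤ) :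
    e 0 (e i x) = (ξ + i) • e i x := by
  have := h.bracket 0 i x
  simp only [hx, map_smul, Int.cast_zero, zero_add, sub_zero] at this
  rw [this]
  split_ifs <;> module

theorem mem_weight (h : VirasoroAction e γ) {ξ : k} {x : M}
    (hx : x ∈ (e 0).eigenspace ξ) (i : ℤ) {η : k} (hη : ξ + i = η) :
    e i x ∈ (e 0).eigenspace η := by
  rw [Module.End.mem_eigenspace_iff] at *
  rw [h.weight_shift hx, hη]

/-- The subspace spanned by the words of total degree `n` in `e (-1)`, `e (-2)` applied to `v`. -/
def lowering (e : ℤ → Module.End k M) (v : M) : ℕ → Submodule k M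
  | 0 => Submodule.span k {v}
  | 1 => (Submodule.span k {v}).map (e (-1))
  | n + 2 => (lowering e v (n + 1)).map (e (-1)) ⊔ (lowering e v n).map (e (-2))

theorem lowering_fg (e : ℤ → Module.End k M) (v : M) (n : ℕ) : (lowering e v n).FG := by
  induction n using Nat.strong_induction_on with
  | _ n ih =>
    match n with
    | 0 => exact Submodule.fg_span_singleton v
    | 1 => exact (Submodule.fg_span_singleton v).map _
    | n + 2 => exact ((ih (n + 1) (by omega)).map _).sup ((ih n (by omega)).map _)

theorem lowering_le_weight (h : VirasoroAction e γ) {ν : k} {v : M} (hv : e 0 v = ν • v) (n : ℕ) :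
    lowering e v n ≤ (e 0).eigenspace (ν - n) := by
  have h0 : Submodule.span k {v} ≤ (e 0).eigenspace ν := by
    rw [Submodule.span_singleton_le_iff_mem, Module.End.mem_eigenspace_iff, hv]
  induction n using Nat.strong_induction_on with
  | _ n ih =>
    match n with
    | 0 => simpa [lowering] using h0
    | 1 =>
      rw [lowering, Submodule.map_le_iff_le_comap]
      exact fun x hx => h.mem_weight (h0 hx) (-1) (by push_cast; ring)
    | n + 2 =>
      rw [lowering, sup_le_iff, Submodule.map_le_iff_le_comap, Submodule.map_le_iff_le_comap]
      exact ⟨fun x hx => h.mem_weight (ih (n + 1) (by omega) hx) (-1) (by push_cast; ring),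
        fun x hx => h.mem_weight (ih n (by omega) hx) (-2) (by push_cast; ring)⟩

theorem iSup_lowering_stable (h : VirasoroAction e γ) {ν : k} {v : M} (hv : e 0 v = ν • v)
    (h1 : e 1 v = 0) (h2 : e 2 v = 0) :
    ∀ x ∈ ⨆ n, lowering e v n, e 1 x ∈ ⨆ n, lowering e v n ∧ e (-1) x ∈ ⨆ n, lowering e v n ∧
      e 2 x ∈ ⨆ n, lowering e v n ∧ e (-2) x ∈ ⨆ n, lowering e v n := by
  set S := ⨆ n, lowering e v n with hS
  have hle : ∀ n, lowering e v n ≤ S := le_iSup _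
  have hvS : v ∈ S := hle 0 (Submodule.mem_span_singleton_self v)
  have hm1 : S ≤ S.comap (e (-1)) := by
    refine iSup_le fun n => Submodule.map_le_iff_le_comap.1 (le_trans ?_ (hle (n + 1)))
    rcases n with _ | n
    · exact le_rfl
    · exact le_sup_left
  have hm2 : S ≤ S.comap (e (-2)) :=
    iSup_le fun n => Submodule.map_le_iff_le_comap.1 (le_trans le_sup_right (hle (n + 2)))
  set T := S ⊓ S.comap (e 0) ⊓ S.comap (e 1) ⊓ S.comap (e 2) with hT
  have hmem : ∀ x, x ∈ T ↔ ((x ∈ S ∧ e 0 x ∈ S) ∧ e 1 x ∈ S) ∧ e 2 x ∈ S := fun x => by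
    simp [hT]
  have hvT : Submodule.span k {v} ≤ T := by
    rw [Submodule.span_singleton_le_iff_mem, hmem, hv, h1, h2]
    exact ⟨⟨⟨hvS, S.smul_mem _ hvS⟩, S.zero_mem⟩, S.zero_mem⟩
  have hcomm : ∀ (i j n : ℤ) (x : M), i + j = n → e i x ∈ S.comap (e j) → e n x ∈ S → x ∈ S →
      e i (e j x) ∈ S := by
    rintro i j _ x rfl hx1 hx2 hx3
    rw [h.bracket i j x]
    exact S.add_mem (S.add_mem hx1 (S.smul_mem _ hx2)) (S.smul_mem _ hx3)
  have hT1 : T ≤ T.comap (e (-1)) := by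
    intro x hx
    obtain ⟨⟨⟨a, b⟩, c⟩, d⟩ := (hmem x).1 hx
    exact (hmem _).2 ⟨⟨⟨hm1 a, hcomm 0 (-1) (-1) x (by norm_num) (hm1 b) (hm1 a) a⟩,
      hcomm 1 (-1) 0 x (by norm_num) (hm1 c) b a⟩, hcomm 2 (-1) 1 x (by norm_num) (hm1 d) c a⟩
  have hT2 : T ≤ T.comap (e (-2)) := by
    intro x hx
    obtain ⟨⟨⟨a, b⟩, c⟩, d⟩ := (hmem x).1 hx
    exact (hmem _).2 ⟨⟨⟨hm2 a, hcomm 0 (-2) (-2) x (by norm_num) (hm2 b) (hm2 a) a⟩,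
      hcomm 1 (-2) (-1) x (by norm_num) (hm2 c) (hm1 a) a⟩,
      hcomm 2 (-2) 0 x (by norm_num) (hm2 d) b a⟩
  have hST : S ≤ T := by
    refine iSup_le fun n => ?_
    induction n using Nat.strong_induction_on with
    | _ n ih =>
      match n with
      | 0 => exact hvT
      | 1 => exact Submodule.map_le_iff_le_comap.2 (hvT.trans hT1)
      | n + 2 =>
        exact sup_le (Submodule.map_le_iff_le_comap.2 ((ih (n + 1) (by omega)).trans hT1))
          (Submodule.map_le_iff_le_comap.2 ((ih n (by omega)).trans hT2))
  intro x hx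
  obtain ⟨⟨-, c⟩, d⟩ := (hmem x).1 (hST hx)
  exact ⟨c, hm1 hx, d, hm2 hx⟩

/-- Every weight of an irreducible action lies in a single coset of `ℤ`. -/
theorem weight_fg_of_coset (h : VirasoroAction e γ) (hirr : IrreducibleAction e) {μ : k}
    (hμ : (e 0).eigenspace μ ≠ ⊥) (hfg : ∀ n : ℤ, ((e 0).eigenspace (μ + n)).FG) (ξ : k) :
    ((e 0).eigenspace ξ).FG := by
  set S := ⨆ n : ℤ, (e 0).eigenspace (μ + n) with hS
  have hstab : ∀ i : ℤ, S ≤ S.comap (e i) := fun i => iSup_le fun n x hx =>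
    le_iSup (fun n : ℤ => (e 0).eigenspace (μ + n)) (n + i)
      (h.mem_weight hx i (by push_cast; ring))
  have htop : S = ⊤ := by
    refine (hirr S fun x hx => ⟨hstab _ hx, hstab _ hx, hstab _ hx, hstab _ hx⟩).resolve_left
      fun hbot => hμ ?_
    rw [← le_bot_iff, ← hbot]
    simpa using le_iSup (fun n : ℤ => (e 0).eigenspace (μ + n)) 0
  refine Submodule.FG.of_le ?_
    (eigenspace_le_of_iSup_eq_top_s18 (e 0) _ (fun n : ℤ => μ + n) (fun _ => le_rfl) htop ξ)
  by_cases hξ : ∃ n : ℤ, μ + n = ξ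
  · obtain ⟨n, rfl⟩ := hξ
    refine (hfg n).of_le (iSup₂_le fun m hm => ?_)
    rw [hm]
  · push Not at hξ
    simp [hξ, Submodule.fg_bot]

theorem irreducible_mirror (hirr : IrreducibleAction e) :
    IrreducibleAction (fun i => -e (-i)) := by
  intro N hN
  refine hirr N fun x hx => ?_
  obtain ⟨a, b, c, d⟩ := hN x hx
  simp only [LinearMap.neg_apply, neg_mem_iff, neg_neg] at a b c d
  exact ⟨b, a, d, c⟩

theorem eigenspace_mirror (e : ℤ → Module.End k M) (ξ : k) :
    Module.End.eigenspace ((fun i => -e (-i)) 0) (-ξ) = (e 0).eigenspace ξ := by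
  ext x
  simp

variable [CharZero k]

theorem eq_zero_of_bracket (h : VirasoroAction e γ) {i j : ℤ} (hij : i + j ≠ 0) (hne : i ≠ j)
    {x : M} (h1 : e i (e j x) = 0) (h2 : e j (e i x) = 0) : e (i + j) x = 0 := by
  have := h.bracket_of_add_ne_zero hij x
  rw [h1, h2, zero_add, eq_comm, smul_eq_zero] at this
  refine this.resolve_left fun h0 => hne ?_
  exact_mod_cast (sub_eq_zero.1 h0).symm

theorem mem_of_bracket (h : VirasoroAction e γ) {i j n : ℤ} (hn : i + j = n) (hne : i ≠ j)
    (N : Submodule k M)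
    (hi : ∀ x ∈ N, e i x ∈ N) (hj : ∀ x ∈ N, e j x ∈ N) : ∀ x ∈ N, e n x ∈ N := by
  intro x hx
  subst hn
  have := h.bracket i j x
  have hc : ((j : k) - i) ≠ 0 := fun h0 => hne (by exact_mod_cast (sub_eq_zero.1 h0).symm)
  rw [← N.smul_mem_iff hc]
  have h3 : ((j : k) - i) • e (i + j) x = e i (e j x) - e j (e i x) -
    (if i + j = 0 then ((i : k) ^ 3 - i) / 12 * γ else 0) • x := by rw [this]; abel
  rw [h3]
  exact N.sub_mem (N.sub_mem (hi _ (hj _ hx)) (hj _ (hi _ hx))) (N.smul_mem _ hx)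

theorem mem_of_nat (h : VirasoroAction e γ) (N : Submodule k M)
    (h1 : ∀ x ∈ N, e 1 x ∈ N) (h2 : ∀ x ∈ N, e 2 x ∈ N) (n : ℕ) :
    ∀ x ∈ N, e (n + 1) x ∈ N := by
  induction n with
  | zero => simpa using h1
  | succ n ih =>
    rcases n with _ | n
    · simpa using h2
    · exact h.mem_of_bracket (i := 1) (by push_cast; ring) (by push_cast; omega) N h1 ih

theorem mem_of_generators (h : VirasoroAction e γ) (N : Submodule k M)
    (hN : ∀ x ∈ N, e 1 x ∈ N ∧ e (-1) x ∈ N ∧ e 2 x ∈ N ∧ e (-2) x ∈ N) (i : ℤ) :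
    ∀ x ∈ N, e i x ∈ N := by
  obtain ⟨n, rfl | rfl⟩ := i.eq_nat_or_neg
  · rcases n with _ | n
    · exact h.mem_of_bracket (i := 1) (j := -1) (by simp) (by simp) N
        (fun x hx => (hN x hx).1) (fun x hx => (hN x hx).2.1)
    · exact_mod_cast h.mem_of_nat N (fun x hx => (hN x hx).1) (fun x hx => (hN x hx).2.2.1) n
  · rcases n with _ | n
    · exact h.mem_of_bracket (i := 1) (j := -1) (by simp) (by simp) N
        (fun x hx => (hN x hx).1) (fun x hx => (hN x hx).2.1)
    · intro x hx
      have := h.mirror.mem_of_nat N (fun x hx => by simpa using (hN x hx).2.1)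
        (fun x hx => by simpa using (hN x hx).2.2.2) n x hx
      simpa using this

/-- A singular vector forces all weight spaces to be finite-dimensional. -/
theorem weight_fg_of_singular (h : VirasoroAction e γ) (hirr : IrreducibleAction e)
    (hs : ¬ NoSingularVector e) (ξ : k) : ((e 0).eigenspace ξ).FG := by
  simp only [NoSingularVector, not_forall] at hs
  obtain ⟨ν, v, hv, h1, h2, hv0⟩ := hs
  have htop : ⨆ n, lowering e v n = ⊤ := by
    refine (hirr _ (h.iSup_lowering_stable hv h1 h2)).resolve_left fun hbot => hv0 ?_
    have : v ∈ ⨆ n, lowering e v n :=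
      le_iSup (lowering e v) 0 (Submodule.mem_span_singleton_self v)
    simpa [hbot] using this
  refine Submodule.FG.of_le ?_
    (eigenspace_le_of_iSup_eq_top_s18 (e 0) _ _ (h.lowering_le_weight hv) htop ξ)
  by_cases hξ : ∃ n : ℕ, ν - n = ξ
  · obtain ⟨n, rfl⟩ := hξ
    refine (lowering_fg e v n).of_le (iSup₂_le fun m hm => ?_)
    have : m = n := by exact_mod_cast sub_right_injective hm
    rw [this]
  · push Not at hξ
    simp [hξ, Submodule.fg_bot]

/-- If `κ + 1` and `κ + j` with `j ≥ 2` have finite-dimensional weight spaces, so has `κ`. -/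
theorem weight_fg_of_two (h : VirasoroAction e γ) (hs : NoSingularVector e) {κ : k} {j : ℤ}
    (hj : 2 ≤ j) (h1 : ((e 0).eigenspace (κ + 1)).FG) (h2 : ((e 0).eigenspace (κ + j)).FG) :
    ((e 0).eigenspace κ).FG := by
  by_contra hκ
  have hV1 := Submodule.not_fg_inf_ker hκ h1 (e 1)
    fun x hx => h.mem_weight hx 1 (by push_cast; ring)
  have hV2 := Submodule.not_fg_inf_ker hV1 h2 (e j) fun x hx => h.mem_weight hx.1 j rfl
  set V := (e 0).eigenspace κ ⊓ LinearMap.ker (e 1) ⊓ LinearMap.ker (e j) with hV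
  have hVe : ∀ v ∈ V, e 0 v = κ • v ∧ e 1 v = 0 ∧ ∀ n : ℕ, e (j + n) v = 0 := by
    rintro v ⟨⟨hv0, hv1⟩, hvj⟩
    refine ⟨Module.End.mem_eigenspace_iff.1 hv0, hv1, fun n => ?_⟩
    induction n with
    | zero => simpa using hvj
    | succ n ih =>
      have : e (1 + (j + n)) v = 0 := by
        refine h.eq_zero_of_bracket (by omega) (by omega) ?_ ?_
        · rw [ih, map_zero]
        · rw [hv1, map_zero]
      rw [← this]
      push_cast
      ring_nf
  have hW : ¬ (V.map (e 2)).FG := by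
    intro hfg
    refine hV2 (Submodule.fg_of_fg_map_of_fg_inf_ker (e 2) hfg ?_)
    have : V ⊓ LinearMap.ker (e 2) = ⊥ := by
      rw [Submodule.eq_bot_iff]
      rintro v ⟨hv, hv2⟩
      exact hs κ v (hVe v hv).1 (hVe v hv).2.1 hv2
    rw [this]
    exact Submodule.fg_bot
  have hW1 := Submodule.not_fg_inf_ker hW h1 (e (-1)) (by
    rintro _ ⟨v, hv, rfl⟩
    refine h.mem_weight (h.mem_weight hv.1.1 2 rfl) (-1) ?_
    push_cast; ring)
  obtain ⟨_, ⟨⟨v, hv, rfl⟩, hw⟩, hne⟩ := Submodule.exists_ne_zero_of_not_fg hW1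
  obtain ⟨hv0, hv1, hvj⟩ := hVe v hv
  set w := e 2 v with hwdef
  have hup : e j w = 0 := by
    rcases hj.eq_or_lt with rfl | hj'
    · have := hvj 0
      simp only [Nat.cast_zero, add_zero] at this
      rw [hwdef, this, map_zero]
    · have hj2 : e j v = 0 := by simpa using hvj 0
      have := h.bracket_of_add_ne_zero (i := j) (j := 2) (by omega) v
      rw [hj2, map_zero, show e (j + 2) v = 0 by simpa using hvj 2] at this
      simpa using this
  have hdown : ∀ n : ℕ, (n : ℤ) < j → e (j - n) w = 0 := by
    intro n
    induction n with
    | zero => exact fun _ => by simpa using hup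
    | succ n ih =>
      intro hn
      push_cast at hn
      have : e (-1 + (j - n)) w = 0 := by
        refine h.eq_zero_of_bracket (by omega) (by omega) ?_ ?_
        · rw [ih (by omega), map_zero]
        · rw [LinearMap.mem_ker.1 hw, map_zero]
      rw [← this]
      push_cast
      ring_nf
  refine hne (hs (κ + (2 : ℤ)) w (h.weight_shift hv0 2) ?_ ?_)
  · have := hdown (j - 1).toNat (by omega)
    rwa [show j - ((j - 1).toNat : ℤ) = 1 by omega] at this
  · have := hdown (j - 2).toNat (by omega)
    rwa [show j - ((j - 2).toNat : ℤ) = 2 by omega] at this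

theorem coset_fg_of_consecutive (h : VirasoroAction e γ) (hs : NoSingularVector e)
    (hs' : NoSingularVector fun i => -e (-i)) {μ : k} (h0 : ((e 0).eigenspace μ).FG)
    (h1 : ((e 0).eigenspace (μ - 1)).FG) (n : ℤ) : ((e 0).eigenspace (μ + n)).FG := by
  have hup : ∀ n : ℕ, ((e 0).eigenspace (μ + n)).FG := by
    intro n
    induction n with
    | zero => simpa using h0
    | succ n ih =>
      rw [← eigenspace_mirror]
      refine h.mirror.weight_fg_of_two hs' (j := n + 2) (by omega) ?_ ?_
      · rw [← eigenspace_mirror] at ih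
        convert ih using 2
        push_cast; ring
      · rw [← eigenspace_mirror] at h1
        convert h1 using 2
        push_cast; ring
  have hdown : ∀ n : ℕ, ((e 0).eigenspace (μ - n)).FG := by
    intro n
    induction n with
    | zero => simpa using h0
    | succ n ih =>
      refine h.weight_fg_of_two hs (j := n + 2) (by omega) ?_ ?_
      · convert ih using 2
        push_cast; ring
      · convert hup 1 using 2
        push_cast; ring
  obtain ⟨m, rfl | rfl⟩ := n.eq_nat_or_neg
  · simpa using hup m
  · simpa [sub_eq_add_neg] using hdown m

theorem cubic_relation (h : VirasoroAction e γ) {v : M} (h1 : e 1 v = 0) :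
    e 1 (e 1 (e 1 (e 2 v))) - (6 : k) • e 2 (e 1 (e 2 v)) + (6 : k) • e 3 (e 2 v) = 0 := by
  have h3 := h.bracket 1 2 v
  have h4 := h.bracket 1 3 v
  have h5 := h.bracket 1 4 v
  have h5' := h.bracket 2 3 v
  norm_num [h1] at h3 h4 h5 h5'
  rw [← h3] at h4 h5'
  have e1 : e 1 (e 1 (e 1 (e 2 v))) = (2 : k) • e 1 (e 4 v) := by rw [h4, map_smul]
  linear_combination (norm := module) e1 + (2 : k) • h5 - (6 : k) • h5'

theorem lower_cubic (h : VirasoroAction e γ) {ν : k} {w : M} (h0 : e 0 w = ν • w)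
    (hl : e (-1) w = 0)
    (hc : e 1 (e 1 (e 1 w)) - (6 : k) • e 2 (e 1 w) + (6 : k) • e 3 w = 0) :
    (ν - 2) • (e 1 (e 1 w) - (2 : k) • e 2 w) = 0 := by
  have a1 := h.bracket (-1) 1 w
  have h01 := h.weight_shift h0 1
  have h02 := h.weight_shift h01 1
  have a2 := h.bracket (-1) 1 (e 1 w)
  have a3 := h.bracket (-1) 1 (e 1 (e 1 w))
  have a4 := h.bracket (-1) 2 w
  have a5 := h.bracket (-1) 2 (e 1 w)
  have a6 := h.bracket (-1) 3 w
  norm_num [hl, h0] at a1 a4 a6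
  norm_num [a1, h01] at a2 a5
  norm_num [a2, h02] at a3
  have := congrArg (e (-1)) hc
  simp only [map_add, map_sub, map_smul, map_zero, a3, a5, a6] at this
  have h6 : (6 : k) ≠ 0 := by norm_num
  refine (smul_eq_zero.1 ?_).resolve_left h6
  linear_combination (norm := module) this

theorem lower_quadratic (h : VirasoroAction e γ) {ν : k} {w : M} (h0 : e 0 w = ν • w)
    (hl : e (-1) w = 0) (hq : e 1 (e 1 w) - (2 : k) • e 2 w = 0) :
    (ν - 1) • e 1 w = 0 := by
  have a1 := h.bracket (-1) 1 w
  have h01 := h.weight_shift h0 1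
  have a2 := h.bracket (-1) 1 (e 1 w)
  have a4 := h.bracket (-1) 2 w
  norm_num [hl, h0] at a1 a4
  norm_num [a1, h01] at a2
  have := congrArg (e (-1)) hq
  simp only [map_sub, map_smul, map_zero, a2, a4] at this
  have h6 : (4 : k) ≠ 0 := by norm_num
  refine (smul_eq_zero.1 ?_).resolve_left h6
  linear_combination (norm := module) this

theorem weight_eq_of_no_singular (h : VirasoroAction e γ) (hs : NoSingularVector e) {ν : k}
    {v : M} (h0 : e 0 (e 2 v) = ν • e 2 v) (h1 : e 1 v = 0) (hl : e (-1) (e 2 v) = 0)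
    (hw : e 2 v ≠ 0) : ν = 1 ∨ ν = 2 := by
  by_contra! hν
  have hq := (smul_eq_zero.1 (h.lower_cubic h0 hl (h.cubic_relation h1))).resolve_left
    (sub_ne_zero.2 hν.2)
  have h1w := (smul_eq_zero.1 (h.lower_quadratic h0 hl hq)).resolve_left (sub_ne_zero.2 hν.1)
  refine hw (hs ν _ h0 h1w ?_)
  simpa [h1w] using hq

end VirasoroAction

/-- The vectors `X n`, of weight `n + 1`, span a half of the action `e i x_s = s x_{s + i}`. -/
structure HalfChain {k M : Type*} [Field k] [AddCommGroup M] [Module k M]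
    (e : ℤ → Module.End k M) (X : ℕ → M) : Prop where
  weight : ∀ n, e 0 (X n) = (n + 1 : k) • X n
  raise_one : ∀ n, e 1 (X n) = (n + 1 : k) • X (n + 1)
  raise_two : ∀ n, e 2 (X n) = (n + 1 : k) • X (n + 2)
  lower_one_zero : e (-1) (X 0) = 0
  lower_one : ∀ n, e (-1) (X (n + 1)) = (n + 2 : k) • X n
  lower_two_one : e (-2) (X 1) = 0
  lower_two : ∀ n, e (-2) (X (n + 2)) = (n + 3 : k) • X n

/-- The vectors obtained from `w` by the divided powers of `e 1`. -/
def chain {k M : Type*} [Field k] [AddCommGroup M] [Module k M]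
    (e : ℤ → Module.End k M) (w : M) : ℕ → M
  | 0 => w
  | n + 1 => (n + 1 : k)⁻¹ • e 1 (chain e w n)

namespace VirasoroAction

variable {k M : Type*} [Field k] [CharZero k] [AddCommGroup M] [Module k M]
  {e : ℤ → Module.End k M} {γ : k}

theorem halfChain (h : VirasoroAction e γ) (hs : NoSingularVector e)
    (hs' : NoSingularVector fun i => -e (-i)) {v : M} (h1 : e 1 v = 0)
    (hw0 : e 2 v ≠ 0) (h0 : e 0 (e 2 v) = e 2 v)
    (hl : e (-1) (e 2 v) = 0) (hl2 : e 1 (e (-2) (e 2 v)) = 0) :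
    HalfChain e (chain e (e 2 v)) ∧ e 2 (e (-2) (e 2 v)) = -e 2 v := by
  have hP := h.cubic_relation h1
  have h0' : e 0 (e 2 v) = (1 : k) • e 2 v := by rw [h0, one_smul]
  have hQ := (smul_eq_zero.1 (h.lower_cubic h0' hl hP)).resolve_left (by norm_num)
  set w := e 2 v with hw
  set X := chain e w with hX
  have hne : ∀ n : ℕ, (n + 1 : k) ≠ 0 := fun n => by exact_mod_cast n.succ_ne_zero
  have hX0 : X 0 = w := rfl
  have hXs : ∀ n, X (n + 1) = (n + 1 : k)⁻¹ • e 1 (X n) := fun n => rfl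
  have raise_one : ∀ n, e 1 (X n) = (n + 1 : k) • X (n + 1) := fun n => by
    rw [hXs, smul_inv_smul₀ (hne n)]
  have hcancel : ∀ (n : ℕ) (x y : M), (n + 1 : k) • x = (n + 1 : k) • y → x = y :=
    fun n x y hxy => (smul_right_injective M (hne n)) hxy
  have weight : ∀ n, e 0 (X n) = (n + 1 : k) • X n := by
    intro n
    induction n with
    | zero => simpa [hX0] using h0
    | succ n ih =>
      rw [hXs, map_smul, h.weight_shift ih 1]
      push_cast
      module
  have lower_one : ∀ n, e (-1) (X (n + 1)) = (n + 2 : k) • X n := by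
    intro n
    induction n with
    | zero =>
      refine hcancel 0 _ _ ?_
      have hb := h.bracket (-1) 1 (X 0)
      norm_num [weight] at hb
      rw [← map_smul, ← raise_one, hb, hX0, hl, map_zero]
      push_cast
      module
    | succ n ih =>
      refine hcancel (n + 1) _ _ ?_
      have hb := h.bracket (-1) 1 (X (n + 1))
      norm_num [weight] at hb
      rw [← map_smul, ← raise_one, hb, ih, map_smul, raise_one]
      push_cast
      module
  have lower_two_one : e (-2) (X 1) = 0 := by
    have hb := h.bracket (-2) 1 (X 0)
    norm_num at hb
    rw [raise_one, hX0, hl2, hl] at hb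
    simpa using hb
  have lower_two : ∀ n, e (-2) (X (n + 2)) = (n + 3 : k) • X n := by
    intro n
    induction n with
    | zero =>
      refine hcancel 1 _ _ ?_
      have hb := h.bracket (-2) 1 (X 1)
      norm_num at hb
      rw [← map_smul, ← raise_one, hb, lower_two_one, lower_one 0, map_zero]
      push_cast
      module
    | succ n ih =>
      refine hcancel (n + 2) _ _ ?_
      have hb := h.bracket (-2) 1 (X (n + 2))
      norm_num at hb
      have := raise_one (n + 2)
      push_cast at this ⊢
      rw [← map_smul, ← this, hb, ih, lower_one (n + 1), map_smul, raise_one]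
      push_cast
      module
  have x1 : X 1 = e 1 w := by simp [hXs, hX0]
  have x2 : (2 : k) • X 2 = e 1 (e 1 w) := by
    rw [← x1, raise_one]
    norm_num
  have x3 : (6 : k) • X 3 = e 1 (e 1 (e 1 w)) := by
    rw [← x2, map_smul, raise_one]
    push_cast
    module
  have raise_two_zero : e 2 (X 0) = X 2 := by
    rw [hX0]
    refine hcancel 1 _ _ ?_
    push_cast
    linear_combination (norm := module) -hQ - x2
  have raise_two_one : e 2 (X 1) = (2 : k) • X 3 := by
    have hb := h.bracket 1 2 w
    norm_num at hb
    rw [← x3, ← x1] at hP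
    rw [← x1, ← hX0, raise_two_zero, raise_one, hX0] at hb
    refine hcancel 11 _ _ ?_
    push_cast at hb ⊢
    linear_combination (norm := module) (-6 : k) • hb - hP
  have hγ : γ = 0 := by
    have hb := h.bracket (-2) 2 (X 1)
    rw [raise_two_one, map_smul, lower_two, lower_two_one] at hb
    norm_num [weight] at hb
    have hX1 : X 1 ≠ 0 := by
      intro hzero
      refine hw0 (hs 1 w h0' (x1 ▸ hzero) ?_)
      rw [← hX0, raise_two_zero]
      have := raise_one 1
      rw [hzero, map_zero, eq_comm, smul_eq_zero] at this
      exact this.resolve_left (hne 1)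
    refine (smul_eq_zero.1 (?_ : γ • X 1 = 0)).resolve_right hX1
    linear_combination (norm := module) (2 : k) • hb
  have hmid : e 2 (e (-2) w) = -w := by
    have hb := h.bracket (-2) 2 (X 0)
    rw [raise_two_zero, lower_two, hγ, hX0] at hb
    norm_num [h0] at hb
    linear_combination (norm := module) -hb
  have raise_two : ∀ n, e 2 (X n) = (n + 1 : k) • X (n + 2) := by
    intro n
    induction n using Nat.strong_induction_on with
    | _ n ih =>
      match n with
      | 0 => simpa using raise_two_zero
      | 1 =>
        rw [raise_two_one]
        norm_num
      | n + 2 =>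
        have hb := h.bracket (-1) 2 (X (n + 2))
        have hb2 := h.bracket (-2) 2 (X (n + 2))
        have i1 := ih (n + 1) (by omega)
        have i2 := ih n (by omega)
        norm_num [raise_one, lower_one, lower_two, weight, hγ, i1, i2] at hb hb2
        rw [← sub_eq_zero]
        refine hs' (-(n + 5 : k)) _ ?_ ?_ ?_
        · have := h.weight_shift (weight (n + 2)) 2
          simp only [LinearMap.neg_apply, neg_zero, map_sub, map_smul, weight, this]
          push_cast
          module
        · have := lower_one (n + 3)
          simp only [LinearMap.neg_apply, map_sub, map_smul]
          rw [hb, show n + 2 + 2 = n + 3 + 1 from rfl, this]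
          push_cast
          module
        · have := lower_two (n + 2)
          simp only [LinearMap.neg_apply, map_sub, map_smul]
          rw [hb2, this]
          push_cast
          module
  exact ⟨⟨weight, raise_one, raise_two, hl, lower_one, lower_two_one, lower_two⟩, hmid⟩

/-- Two half chains joined by `e 2` and `e (-2)` span a submodule without weight `0`. -/
theorem weight_zero_eq_bot_of_halfChain (hirr : IrreducibleAction e) {X Y : ℕ → M}
    (hX : HalfChain e X) (hY : HalfChain (fun i => -e (-i)) Y) (hX0 : X 0 ≠ 0)
    (hXY : e (-2) (X 0) = -Y 0) (hYX : e 2 (Y 0) = X 0) : (e 0).eigenspace 0 = ⊥ := by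
  set N := Submodule.span k (Set.range X ∪ Set.range Y) with hN
  have hXN : ∀ n, X n ∈ N := fun n => Submodule.subset_span (Or.inl ⟨n, rfl⟩)
  have hYN : ∀ n, Y n ∈ N := fun n => Submodule.subset_span (Or.inr ⟨n, rfl⟩)
  have hY1 := hY.weight
  have hY2 := hY.raise_one
  have hY3 := hY.raise_two
  have hY4 := hY.lower_one_zero
  have hY5 := hY.lower_one
  have hY6 := hY.lower_two_one
  have hY7 := hY.lower_two
  simp only [LinearMap.neg_apply, neg_neg, neg_zero,
    neg_eq_iff_eq_neg] at hY1 hY2 hY3 hY4 hY5 hY6 hY7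
  have hmem : ∀ {x y : M}, x = y → y ∈ N → x ∈ N := fun hxy hy => hxy ▸ hy
  have hstab : N ≤ N.comap (e 1) ⊓ N.comap (e (-1)) ⊓ N.comap (e 2) ⊓ N.comap (e (-2)) := by
    refine Submodule.span_le.2 ?_
    rintro _ (⟨n, rfl⟩ | ⟨n, rfl⟩)
    · refine ⟨⟨⟨?_, ?_⟩, ?_⟩, ?_⟩
      · exact hmem (hX.raise_one n) (N.smul_mem _ (hXN _))
      · rcases n with _ | n
        · exact hmem hX.lower_one_zero N.zero_mem
        · exact hmem (hX.lower_one n) (N.smul_mem _ (hXN _))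
      · exact hmem (hX.raise_two n) (N.smul_mem _ (hXN _))
      · rcases n with _ | _ | n
        · exact hmem hXY (N.neg_mem (hYN 0))
        · exact hmem hX.lower_two_one N.zero_mem
        · exact hmem (hX.lower_two n) (N.smul_mem _ (hXN _))
    · refine ⟨⟨⟨?_, ?_⟩, ?_⟩, ?_⟩
      · rcases n with _ | n
        · exact hmem hY4 N.zero_mem
        · exact hmem (hY5 n) (N.neg_mem (N.smul_mem _ (hYN _)))
      · exact hmem (hY2 n) (N.neg_mem (N.smul_mem _ (hYN _)))
      · rcases n with _ | _ | n
        · exact hmem hYX (hXN 0)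
        · exact hmem hY6 N.zero_mem
        · exact hmem (hY7 n) (N.neg_mem (N.smul_mem _ (hYN _)))
      · exact hmem (hY3 n) (N.neg_mem (N.smul_mem _ (hYN _)))
  have htop : N = ⊤ := by
    refine (hirr N fun x hx => ?_).resolve_left fun hbot => hX0 ?_
    · obtain ⟨⟨⟨a, b⟩, c⟩, d⟩ := hstab hx
      exact ⟨a, b, c, d⟩
    · simpa [hbot] using hXN 0
  have hle : N ≤ ⨆ (η) (_ : η ≠ 0), (e 0).eigenspace η := by
    rw [hN, Submodule.span_le]
    rintro _ (⟨n, rfl⟩ | ⟨n, rfl⟩)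
    · exact le_iSup₂_of_le (f := fun η (_ : η ≠ 0) => (e 0).eigenspace η) (n + 1 : k)
        (by exact_mod_cast n.succ_ne_zero) le_rfl
        (Module.End.mem_eigenspace_iff.2 (hX.weight n))
    · exact le_iSup₂_of_le (f := fun η (_ : η ≠ 0) => (e 0).eigenspace η) (-(n + 1 : k))
        (neg_ne_zero.2 (by exact_mod_cast n.succ_ne_zero)) le_rfl
        (Module.End.mem_eigenspace_iff.2 (by rw [hY1, neg_smul]))
  have hind := (e 0).eigenspaces_iSupIndep 0
  rw [htop, top_le_iff] at hle
  rw [hle] at hind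
  exact disjoint_top.1 hind

theorem fg_pred_of_fg (h : VirasoroAction e γ) (hirr : IrreducibleAction e)
    (hs : NoSingularVector e) (hs' : NoSingularVector fun i => -e (-i)) {μ : k}
    (hμ : (e 0).eigenspace μ ≠ ⊥) (hfg : ((e 0).eigenspace μ).FG) :
    ((e 0).eigenspace (μ - 1)).FG := by
  by_contra hinf
  have hV1 := Submodule.not_fg_inf_ker hinf hfg (e 1)
    fun x hx => h.mem_weight hx 1 (by push_cast; ring)
  have hV2 := Submodule.not_fg_inf_ker hV1 hfg (e (-1) * e 2)
    fun x hx => h.mem_weight (h.mem_weight hx.1 2 rfl) (-1) (by push_cast; ring)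
  have hV3 := Submodule.not_fg_inf_ker hV2 hfg (e 1 * e (-2) * e 2)
    fun x hx => h.mem_weight (h.mem_weight (h.mem_weight hx.1.1 2 rfl) (-2) rfl) 1
      (by push_cast; ring)
  obtain ⟨v, ⟨⟨⟨hv0, hv1⟩, hl⟩, hl2⟩, hv⟩ := Submodule.exists_ne_zero_of_not_fg hV3
  simp only [SetLike.mem_coe, Module.End.mem_eigenspace_iff, LinearMap.mem_ker,
    Module.End.mul_apply] at hv0 hv1 hl hl2
  have hw0 : e 2 v ≠ 0 := fun hw => hv (hs _ v hv0 hv1 hw)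
  have hw : e 0 (e 2 v) = (μ + 1) • e 2 v := by
    rw [h.weight_shift hv0]
    push_cast
    module
  set w := e 2 v with hwdef
  have hu0 : e (-2) w ≠ 0 := fun hu =>
    hw0 (hs' (-(μ + 1)) w (by simp [hw, ← neg_smul, add_comm]) (by simp [hl]) (by simp [hu]))
  have hμ0 : μ = 0 := by
    have hcase := h.weight_eq_of_no_singular hs hw hv1 hl hw0
    have hcase' := h.mirror.weight_eq_of_no_singular hs' (v := w) (ν := -μ + 1)
      (by
        have := h.weight_shift hw (-2)
        simp only [LinearMap.neg_apply, map_neg, neg_zero, neg_neg, this]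
        push_cast
        module)
      (by simp [hl]) (by simp [hl2]) (by simpa using hu0)
    rcases hcase with hc | hc
    · simpa using hc
    · rcases hcase' with hc' | hc'
      · simpa using hc'
      · exfalso
        have : (2 : k) = 0 := by linear_combination -hc - hc'
        exact two_ne_zero this
  subst hμ0
  rw [zero_add, one_smul] at hw
  obtain ⟨hX, hmid⟩ := h.halfChain hs hs' hv1 hw0 hw hl hl2
  rw [← hwdef] at hX hmid
  obtain ⟨hY, -⟩ := h.mirror.halfChain hs' (by simpa using hs) (v := w) (by simp [hl])
    (by simpa using hu0)
    (by
      have := h.weight_shift (ξ := 1) (x := w) (by rw [hw, one_smul]) (-2)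
      simp only [LinearMap.neg_apply, map_neg, neg_zero, neg_neg, this]
      push_cast
      module)
    (by simp [hl2]) (by simp [hmid, hl])
  refine hμ (weight_zero_eq_bot_of_halfChain hirr hX hY hw0 ?_ ?_)
  · simp [chain]
  · simp [chain, hmid]

/-- An irreducible action with a nonzero finite-dimensional weight space has all its weight
spaces finite-dimensional. -/
theorem weight_fg (h : VirasoroAction e γ) (hirr : IrreducibleAction e) {μ : k}
    (hμ : (e 0).eigenspace μ ≠ ⊥) (hfg : ((e 0).eigenspace μ).FG) (ξ : k) :
    ((e 0).eigenspace ξ).FG := by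
  by_cases hs : NoSingularVector e
  · by_cases hs' : NoSingularVector fun i => -e (-i)
    · exact h.weight_fg_of_coset hirr hμ
        (h.coset_fg_of_consecutive hs hs' hfg (h.fg_pred_of_fg hirr hs hs' hμ hfg)) ξ
    · rw [← eigenspace_mirror]
      exact h.mirror.weight_fg_of_singular (irreducible_mirror hirr) hs' _
  · exact h.weight_fg_of_singular hirr hs ξ

end VirasoroAction

/-- A central element acts by a scalar on an irreducible module in which some weight space is
nonzero and finite-dimensional. -/
theorem exists_central_scalar {k L M : Type*} [Field k] [IsAlgClosed k] [LieRing L]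
    [LieAlgebra k L] [AddCommGroup M] [Module k M] [LieRingModule L M] [LieModule k L M]
    [LieModule.IsIrreducible k L M] (C H : L) (hC : ∀ z : L, ⁅C, z⁆ = 0) (μ : k)
    (hne : Module.End.eigenspace (LieModule.toEnd k L M H) μ ≠ ⊥)
    [FiniteDimensional k (Module.End.eigenspace (LieModule.toEnd k L M H) μ)] :
    ∃ γ : k, ∀ x : M, ⁅C, x⁆ = γ • x := by
  have hcomm : ∀ (z : L) (x : M), ⁅C, ⁅z, x⁆⁆ = ⁅z, ⁅C, x⁆⁆ := fun z x => by
    rw [leibniz_lie, hC, zero_lie, zero_add]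
  have hmaps : ∀ x ∈ Module.End.eigenspace (LieModule.toEnd k L M H) μ,
      LieModule.toEnd k L M C x ∈ Module.End.eigenspace (LieModule.toEnd k L M H) μ := by
    intro x hx
    rw [Module.End.mem_eigenspace_iff, LieModule.toEnd_apply_apply] at *
    rw [LieModule.toEnd_apply_apply, ← hcomm, hx, lie_smul]
  have := Submodule.nontrivial_iff_ne_bot.2 hne
  obtain ⟨γ, hγ⟩ := Module.End.exists_eigenvalue ((LieModule.toEnd k L M C).restrict hmaps)
  obtain ⟨⟨x, hx⟩, hxγ, hx0⟩ := hγ.exists_hasEigenvector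
  have hxC : ⁅C, x⁆ = γ • x := by
    simpa [Module.End.mem_eigenspace_iff, Subtype.ext_iff] using hxγ
  let N : LieSubmodule k L M :=
    { Module.End.eigenspace (LieModule.toEnd k L M C) γ with
      lie_mem := by
        intro z m hm
        change m ∈ Module.End.eigenspace (LieModule.toEnd k L M C) γ at hm
        change ⁅z, m⁆ ∈ Module.End.eigenspace (LieModule.toEnd k L M C) γ
        rw [Module.End.mem_eigenspace_iff, LieModule.toEnd_apply_apply] at *
        rw [hcomm, hm, lie_smul] }
  have hmemN : ∀ m : M, m ∈ N ↔ ⁅C, m⁆ = γ • m := fun m =>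
    Module.End.mem_eigenspace_iff
  have htop : N = ⊤ := by
    refine (eq_bot_or_eq_top N).resolve_left fun hbot => hx0 ?_
    have := (hmemN x).2 hxC
    rw [hbot, LieSubmodule.mem_bot] at this
    exact Subtype.ext this
  exact ⟨γ, fun m => (hmemN m).1 (htop ▸ LieSubmodule.mem_top m)⟩


/-- Let `M` be a simple weight module over the Virasoro algebra such that some
weight space `M_λ` satisfies `0 < dim M_λ < ∞`.  Then all weight spaces of `M`
are finite-dimensional, i.e. `M` is a Harish-Chandra module. -/
theorem virasoro_finite_weight_space_forces_harish_chandra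
    {k : Type*} [Field k] [CharZero k] [IsAlgClosed k]
    {L : Type*} [LieRing L] [LieAlgebra k L]
    (E : ℤ → L) (C : L)
    (hC : ∀ z : L, ⁅C, z⁆ = 0)
    (hE : ∀ i j : ℤ, ⁅E i, E j⁆ =
      (j - i) • E (i + j) + (if i + j = 0 then ((i : k) ^ 3 - (i : k)) / 12 else 0) • C)
    (hspan : Submodule.span k ({C} ∪ Set.range E) = ⊤)
    {M : Type*} [AddCommGroup M] [Module k M] [LieRingModule L M] [LieModule k L M]
    [LieModule.IsIrreducible k L M]
    (hweight : (⨆ μ : k, Module.End.eigenspace (LieModule.toEnd k L M (E 0)) μ) = ⊤)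
    (lam : k)
    (hne : Module.End.eigenspace (LieModule.toEnd k L M (E 0)) lam ≠ ⊥)
    (hfin : FiniteDimensional k
      ↥(Module.End.eigenspace (LieModule.toEnd k L M (E 0)) lam)) :
    ∀ μ : k, FiniteDimensional k
      ↥(Module.End.eigenspace (LieModule.toEnd k L M (E 0)) μ) := by
  obtain ⟨γ, hγ⟩ := exists_central_scalar (M := M) C (E 0) hC lam hne
  set e : ℤ → Module.End k M := fun i => LieModule.toEnd k L M (E i) with he
  have hact : VirasoroAction e γ := by
    refine ⟨fun i j x => ?_⟩
    simp only [he, LieModule.toEnd_apply_apply]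
    rw [leibniz_lie, hE, add_lie, smul_lie, smul_lie, hγ, smul_smul, ite_mul, zero_mul,
      ← Int.cast_smul_eq_zsmul k (j - i), Int.cast_sub]
    abel
  have hirr : IrreducibleAction e := by
    intro N hN
    have hE' := hact.mem_of_generators N hN
    have hL : ∀ (z : L) (x : M), x ∈ N → ⁅z, x⁆ ∈ N := by
      intro z x hx
      have hz : z ∈ Submodule.span k ({C} ∪ Set.range E) := hspan ▸ Submodule.mem_top
      induction hz using Submodule.span_induction with
      | mem y hy =>
        rcases hy with rfl | ⟨i, rfl⟩
        · exact (hγ x).symm ▸ N.smul_mem _ hx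
        · exact hE' i x hx
      | zero => simp
      | add y z _ _ hy hz => exact (add_lie y z x).symm ▸ N.add_mem hy hz
      | smul a y _ hy => exact (smul_lie a y x).symm ▸ N.smul_mem a hy
    rcases eq_bot_or_eq_top (⟨N, fun {z x} hx => hL z x hx⟩ : LieSubmodule k L M) with h | h
    · exact Or.inl (by simpa using congrArg LieSubmodule.toSubmodule h)
    · exact Or.inr (by simpa using congrArg LieSubmodule.toSubmodule h)
  intro μ
  exact Module.Finite.iff_fg.2 (hact.weight_fg hirr hne (Module.Finite.iff_fg.1 hfin) μ)
end

section
/- There exist no simple mixed modules over the Virasoro algebra: no simple weight V-module M admits λ ∈ k and i ∈ ℤ with dim M_λ = ∞ and dim M_{λ+i} < ∞. -/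
section VirasoroAction

open Module

/-- A simple action of the Virasoro algebra, given by the operators `e i` of its standard basis
and the operator `c` of its central element. -/
structure IsSimpleVirasoroAction {k M : Type*} [Field k] [AddCommGroup M] [Module k M]
    (e : ℤ → End k M) (c : End k M) : Prop where
  central : ∀ i x, c (e i x) = e i (c x)
  comm : ∀ i j x, e i (e j x) = e j (e i x) + ((j : k) - i) • e (i + j) x +
    (if i + j = 0 then ((i : k) ^ 3 - i) / 12 else 0) • c x
  eq_bot_or_eq_top : ∀ S : Submodule k M, (∀ i, ∀ x ∈ S, e i x ∈ S) → (∀ x ∈ S, c x ∈ S) →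
    S = ⊥ ∨ S = ⊤

variable {k M : Type*} [Field k] [AddCommGroup M] [Module k M]

section LinearAlgebra

theorem exists_ne_zero_forall_apply_eq_zero {ι : Type*} [Finite ι] (U : Submodule k M)
    (W : ι → Submodule k M) (f : ι → End k M) (hf : ∀ i, ∀ x ∈ U, f i x ∈ W i)
    (hW : ∀ i, FiniteDimensional k (W i)) (hU : ¬ FiniteDimensional k U) :
    ∃ v ∈ U, v ≠ 0 ∧ ∀ i, f i v = 0 := by
  by_contra! H
  refine hU (FiniteDimensional.of_injective
    (LinearMap.pi fun i => (f i).restrict (hf i) : U →ₗ[k] ∀ i, W i) ?_)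
  rw [← LinearMap.ker_eq_bot, LinearMap.ker_eq_bot']
  intro x hx
  by_contra hx0
  obtain ⟨i, hi⟩ := H x x.2 (by simpa using hx0)
  exact hi (congrArg Subtype.val (congrFun hx i))

theorem eigenspace_le_iSup_of_iSup_eq_top {ι : Type*} (f : End k M) (A : ι → Submodule k M)
    (μ : ι → k) (hA : ∀ i, A i ≤ f.eigenspace (μ i)) (htop : ⨆ i, A i = ⊤) (ν : k) :
    f.eigenspace ν ≤ ⨆ i : {i // μ i = ν}, A i := by
  have hle : ⨆ i : {i // μ i = ν}, A i ≤ f.eigenspace ν := by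
    refine iSup_le fun i => ?_
    simpa only [i.2] using hA i
  have hsplit : ⊤ ≤ (⨆ i : {i // μ i = ν}, A i) ⊔ ⨆ ξ, ⨆ _ : ξ ≠ ν, f.eigenspace ξ := by
    rw [← htop]
    refine iSup_le fun i => ?_
    by_cases hi : μ i = ν
    · exact le_sup_of_le_left (le_iSup (fun i : {i // μ i = ν} => A i) ⟨i, hi⟩)
    · exact le_sup_of_le_right ((hA i).trans (le_iSup₂_of_le (μ i) hi le_rfl))
  intro x hx
  obtain ⟨y, hy, z, hz, rfl⟩ := Submodule.mem_sup.1 (hsplit (Submodule.mem_top (x := x)))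
  have hz' : z ∈ f.eigenspace ν := by simpa using sub_mem hx (hle hy)
  rw [Submodule.disjoint_def.1 (f.eigenspaces_iSupIndep ν) z hz' hz, add_zero]
  exact hy

theorem exists_eigenvector_of_aeval_apply_eq_zero [IsAlgClosed k] (f : End k M) {v : M}
    (hv : v ≠ 0) (n : ℕ) (p : Polynomial k) (hn : p.natDegree = n) (hp : p ≠ 0)
    (h : Polynomial.aeval f p v = 0) : ∃ a : k, ∃ u : M, u ≠ 0 ∧ f u = a • u := by
  induction n generalizing p with
  | zero =>
    obtain ⟨a, rfl⟩ := Polynomial.natDegree_eq_zero.1 hn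
    simp_all
  | succ n ih =>
    obtain ⟨a, ha⟩ := IsAlgClosed.exists_root p
      (Polynomial.degree_ne_of_natDegree_ne (hn ▸ n.succ_ne_zero))
    obtain ⟨q, rfl⟩ := Polynomial.dvd_iff_isRoot.2 ha
    have hq : q ≠ 0 := right_ne_zero_of_mul hp
    by_cases h0 : Polynomial.aeval f q v = 0
    · refine ih q ?_ hq h0
      rw [Polynomial.natDegree_mul (left_ne_zero_of_mul hp) hq, Polynomial.natDegree_X_sub_C] at hn
      omega
    · refine ⟨a, _, h0, ?_⟩
      rw [map_mul, Module.End.mul_apply] at h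
      simpa [sub_eq_zero, Module.algebraMap_end_apply] using h

theorem eigenspace_neg (f : End k M) (μ : k) : (-f).eigenspace μ = f.eigenspace (-μ) := by
  ext x
  simp [neg_eq_iff_eq_neg]

end LinearAlgebra

namespace IsSimpleVirasoroAction

variable {e : ℤ → End k M} {c : End k M}

theorem bracket (h : IsSimpleVirasoroAction e c) (i j n : ℤ) (a : k)
    (hn : i + j = n ∧ n ≠ 0 ∧ (j : k) - i = a) (x : M) :
    e i (e j x) = e j (e i x) + a • e n x := by
  obtain ⟨rfl, hn', rfl⟩ := hn
  simpa [hn'] using h.comm i j x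

theorem bracket_zero (h : IsSimpleVirasoroAction e c) (i j : ℤ) (a b : k)
    (hij : i + j = 0 ∧ (j : k) - i = a ∧ ((i : k) ^ 3 - i) / 12 = b) (x : M) :
    e i (e j x) = e j (e i x) + a • e 0 x + b • c x := by
  obtain ⟨hij, rfl, rfl⟩ := hij
  simpa [hij] using h.comm i j x

theorem weight_apply (h : IsSimpleVirasoroAction e c) {μ : k} {x : M} (hx : e 0 x = μ • x)
    (i : ℤ) (ν : k) (hν : μ + i = ν) : e 0 (e i x) = ν • e i x := by
  subst hν
  have := h.comm 0 i x
  simp only [hx, map_smul, Int.cast_zero, sub_zero, zero_add] at this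
  rw [this]
  simp
  module

theorem reflect (h : IsSimpleVirasoroAction e c) :
    IsSimpleVirasoroAction (fun i => -e (-i)) (-c) where
  central i x := by simp [h.central]
  comm i j x := by
    have := h.comm (-i) (-j) x
    have hij : -i + -j = -(i + j) := by ring
    rw [hij] at this
    simp only [LinearMap.neg_apply, map_neg, neg_neg, this, neg_eq_zero]
    split_ifs <;> push_cast <;> module
  eq_bot_or_eq_top S hS hc := by
    refine h.eq_bot_or_eq_top S (fun i x hx => ?_) fun x hx => ?_
    · simpa using hS (-i) x hx
    · simpa using hc x hx

theorem apply_mem_of_pos [CharZero k] (h : IsSimpleVirasoroAction e c) {S : Submodule k M}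
    (h1 : ∀ x ∈ S, e 1 x ∈ S) (h2 : ∀ x ∈ S, e 2 x ∈ S) (n : ℕ) :
    ∀ x ∈ S, e (n + 1) x ∈ S := by
  induction n with
  | zero => simpa using h1
  | succ n ih =>
    rcases Nat.eq_zero_or_pos n with rfl | hn
    · simpa using h2
    intro x hx
    have hn' : (n : k) ≠ 0 := by exact_mod_cast hn.ne'
    have key := h.bracket 1 (n + 1) (n + 1 + 1) n ⟨by ring, by omega, by push_cast; ring⟩ x
    have : e (n + 1 + 1) x = (n : k)⁻¹ • (e 1 (e (n + 1) x) - e (n + 1) (e 1 x)) := by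
      rw [key, add_sub_cancel_left, inv_smul_smul₀ hn']
    push_cast
    rw [this]
    exact S.smul_mem _ (sub_mem (h1 _ (ih x hx)) (ih _ (h1 x hx)))

theorem eq_bot_or_eq_top_of_generators [CharZero k] (h : IsSimpleVirasoroAction e c)
    {S : Submodule k M} (h1 : ∀ x ∈ S, e 1 x ∈ S) (h2 : ∀ x ∈ S, e 2 x ∈ S)
    (h1' : ∀ x ∈ S, e (-1) x ∈ S) (h2' : ∀ x ∈ S, e (-2) x ∈ S) : S = ⊥ ∨ S = ⊤ := by
  have h0 : ∀ x ∈ S, e 0 x ∈ S := fun x hx => by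
    have key := h.bracket_zero (-1) 1 2 0 (by norm_num) x
    have : e 0 x = (2⁻¹ : k) • (e (-1) (e 1 x) - e 1 (e (-1) x)) := by
      rw [key]; module
    rw [this]
    exact S.smul_mem _ (sub_mem (h1' _ (h1 x hx)) (h1 _ (h1' x hx)))
  refine h.eq_bot_or_eq_top S (fun i => ?_) fun x hx => ?_
  · obtain hi | rfl | hi := lt_trichotomy i 0
    · obtain ⟨n, rfl⟩ : ∃ n : ℕ, i = -(n + 1) := ⟨(-i - 1).toNat, by omega⟩
      intro x hx
      simpa using h.reflect.apply_mem_of_pos (S := S) (by simpa using h1') (by simpa using h2')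
        n x hx
    · exact h0
    · obtain ⟨n, rfl⟩ : ∃ n : ℕ, i = n + 1 := ⟨(i - 1).toNat, by omega⟩
      exact h.apply_mem_of_pos h1 h2 n
  · have key := h.bracket_zero (-2) 2 4 (-1 / 2) (by norm_num) x
    have : c x = (-2 : k) • (e (-2) (e 2 x) - e 2 (e (-2) x) - (4 : k) • e 0 x) := by
      rw [key]; module
    rw [this]
    exact S.smul_mem _ (sub_mem (sub_mem (h2' _ (h2 x hx)) (h2 _ (h2' x hx)))
      (S.smul_mem _ (h0 x hx)))

theorem central_eq_smul (h : IsSimpleVirasoroAction e c) {a : k} {u : M} (hu : u ≠ 0)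
    (hcu : c u = a • u) (x : M) : c x = a • x := by
  have htop := (h.eq_bot_or_eq_top (c.eigenspace a) (fun i x hx => ?_) fun x hx => ?_).resolve_left
    fun hbot => hu <| (Submodule.mem_bot k).1 <| hbot ▸ Module.End.mem_eigenspace_iff.2 hcu
  · exact Module.End.mem_eigenspace_iff.1 (htop ▸ Submodule.mem_top)
  · rw [Module.End.mem_eigenspace_iff] at hx ⊢
    rw [h.central, hx, map_smul]
  · rw [Module.End.mem_eigenspace_iff] at hx ⊢
    rw [hx, map_smul, hx]

theorem apply_aeval_central (h : IsSimpleVirasoroAction e c) (i : ℤ) (q : Polynomial k) (x : M) :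
    e i (Polynomial.aeval c q x) = Polynomial.aeval c q (e i x) := by
  induction q using Polynomial.induction_on generalizing x with
  | C a => simp
  | add p q hp hq => simp [hp, hq]
  | monomial n a hq =>
    have := hq (c x)
    simpa [pow_succ, h.central] using this

section HighestWeight

/-- The weight layers of the submodule obtained from a space `T` of weight vectors by applying
`e (-1)` and `e (-2)`. -/
def layer (e : ℤ → End k M) (T : Submodule k M) : ℕ → Submodule k M
  | 0 => T
  | 1 => T.map (e (-1))
  | n + 2 => (layer e T (n + 1)).map (e (-1)) ⊔ (layer e T n).map (e (-2))

theorem map_layer_le (T : Submodule k M) (n : ℕ) :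
    (layer e T n).map (e (-1)) ≤ layer e T (n + 1) := by
  cases n with
  | zero => exact le_rfl
  | succ n => exact le_sup_left

theorem map_layer_le' (T : Submodule k M) (n : ℕ) :
    (layer e T n).map (e (-2)) ≤ layer e T (n + 2) :=
  le_sup_right

theorem layer_induction {T : Submodule k M} {P : ℕ → M → Prop} (zero : ∀ x ∈ T, P 0 x)
    (add_mem : ∀ n x y, P n x → P n y → P n (x + y))
    (neg_one : ∀ n, ∀ x ∈ layer e T n, P n x → P (n + 1) (e (-1) x))
    (neg_two : ∀ n, ∀ x ∈ layer e T n, P n x → P (n + 2) (e (-2) x)) (n : ℕ) :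
    ∀ x ∈ layer e T n, P n x := by
  induction n using Nat.twoStepInduction with
  | zero => exact zero
  | one =>
    rintro _ ⟨x, hx, rfl⟩
    exact neg_one 0 x hx (zero x hx)
  | more n ih ih' =>
    intro x hx
    obtain ⟨_, ⟨y, hy, rfl⟩, _, ⟨z, hz, rfl⟩, rfl⟩ := Submodule.mem_sup.1 hx
    exact add_mem _ _ _ (neg_one _ y hy (ih' y hy)) (neg_two _ z hz (ih z hz))

theorem layer_le_eigenspace (h : IsSimpleVirasoroAction e c) {T : Submodule k M} {μ : k}
    (hT : ∀ x ∈ T, e 0 x = μ • x) (n : ℕ) : ∀ x ∈ layer e T n, e 0 x = (μ - n) • x := by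
  refine layer_induction (P := fun n x => e 0 x = (μ - n) • x) ?_ ?_ ?_ ?_ n
  · simpa using hT
  · intro n x y hx hy
    rw [map_add, hx, hy, smul_add]
  · intro n x _ hx
    exact h.weight_apply hx _ _ (by push_cast; ring)
  · intro n x _ hx
    exact h.weight_apply hx _ _ (by push_cast; ring)

instance (T : Submodule k M) [FiniteDimensional k T] (n : ℕ) :
    FiniteDimensional k (layer e T n) := by
  induction n using Nat.twoStepInduction with
  | zero => assumption
  | one => exact inferInstanceAs (FiniteDimensional k (T.map (e (-1))))
  | more n ih ih' =>
    exact inferInstanceAs (FiniteDimensional k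
      ((layer e T (n + 1)).map (e (-1)) ⊔ (layer e T n).map (e (-2)) : Submodule k M))

theorem iSup_layer_eq_top [CharZero k] (h : IsSimpleVirasoroAction e c) {T : Submodule k M}
    {μ : k} (hT0 : T ≠ ⊥) (hT : ∀ x ∈ T, e 0 x = μ • x) (h1 : ∀ x ∈ T, e 1 x = 0)
    (h2 : ∀ x ∈ T, e 2 x = 0) (hc : ∀ x ∈ T, c x ∈ T) : ⨆ n, layer e T n = ⊤ := by
  set S := ⨆ n, layer e T n with hS
  have hle : ∀ n, ∀ x ∈ layer e T n, x ∈ S := fun n x hx => le_iSup (layer e T) n hx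
  have stable : ∀ f : End k M, (∀ n, ∀ x ∈ layer e T n, f x ∈ S) → ∀ x ∈ S, f x ∈ S := by
    intro f hf
    have : S ≤ S.comap f := iSup_le hf
    exact this
  have hn1 : ∀ x ∈ S, e (-1) x ∈ S := stable _ fun n x hx =>
    hle (n + 1) _ (map_layer_le T n ⟨x, hx, rfl⟩)
  have hn2 : ∀ x ∈ S, e (-2) x ∈ S := stable _ fun n x hx =>
    hle (n + 2) _ (map_layer_le' T n ⟨x, hx, rfl⟩)
  have h0 : ∀ x ∈ S, e 0 x ∈ S := stable _ fun n x hx => by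
    rw [h.layer_le_eigenspace hT n x hx]
    exact S.smul_mem _ (hle n x hx)
  have hcS : ∀ x ∈ S, c x ∈ S := stable _ <| by
    refine layer_induction (P := fun _ x => c x ∈ S) (fun x hx => hle 0 _ (hc x hx)) ?_ ?_ ?_
    · intro n x y hx hy
      rw [map_add]
      exact add_mem hx hy
    · intro n x _ hx
      rw [h.central]
      exact hn1 _ hx
    · intro n x _ hx
      rw [h.central]
      exact hn2 _ hx
  have h1S : ∀ x ∈ S, e 1 x ∈ S := stable _ <| by
    refine layer_induction (P := fun _ x => e 1 x ∈ S) (fun x hx => ?_) ?_ ?_ ?_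
    · rw [h1 x hx]
      exact zero_mem S
    · intro n x y hx hy
      rw [map_add]
      exact add_mem hx hy
    · intro n x hx hx'
      rw [h.bracket_zero 1 (-1) (-2) 0 (by norm_num) x, zero_smul, add_zero]
      exact add_mem (hn1 _ hx') (S.smul_mem _ (h0 x (hle n x hx)))
    · intro n x hx hx'
      rw [h.bracket 1 (-2) (-1) (-3) (by norm_num) x]
      exact add_mem (hn2 _ hx') (S.smul_mem _ (hn1 x (hle n x hx)))
  have h2S : ∀ x ∈ S, e 2 x ∈ S := stable _ <| by
    refine layer_induction (P := fun _ x => e 2 x ∈ S) (fun x hx => ?_) ?_ ?_ ?_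
    · rw [h2 x hx]
      exact zero_mem S
    · intro n x y hx hy
      rw [map_add]
      exact add_mem hx hy
    · intro n x hx hx'
      rw [h.bracket 2 (-1) 1 (-3) (by norm_num) x]
      exact add_mem (hn1 _ hx') (S.smul_mem _ (h1S x (hle n x hx)))
    · intro n x hx hx'
      rw [h.bracket_zero 2 (-2) (-4) (1 / 2) (by norm_num) x]
      exact add_mem (add_mem (hn2 _ hx') (S.smul_mem _ (h0 x (hle n x hx))))
        (S.smul_mem _ (hcS x (hle n x hx)))
  refine (h.eq_bot_or_eq_top_of_generators h1S h2S hn1 hn2).resolve_left fun hbot => hT0 ?_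
  exact eq_bot_iff.2 (hbot ▸ fun x hx => hle 0 x hx)

theorem finiteDimensional_eigenspace_of_highest_weight [CharZero k] [IsAlgClosed k]
    (h : IsSimpleVirasoroAction e c) {μ : k} {v : M} (hv : v ≠ 0) (h0 : e 0 v = μ • v)
    (h1 : e 1 v = 0) (h2 : e 2 v = 0) (ν : k) : FiniteDimensional k ((e 0).eigenspace ν) := by
  have inj : Function.Injective fun n : ℕ => μ - n := fun m n hmn => by simpa using hmn
  have main : ∀ T : Submodule k M, T ≠ ⊥ → (∀ x ∈ T, e 0 x = μ • x) → (∀ x ∈ T, e 1 x = 0) →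
      (∀ x ∈ T, e 2 x = 0) → (∀ x ∈ T, c x ∈ T) → ∀ ν,
      (e 0).eigenspace ν ≤ ⨆ n : {n : ℕ // μ - n = ν}, layer e T n :=
    fun T hT0 hT h1 h2 hc => eigenspace_le_iSup_of_iSup_eq_top _ _ _
      (fun n x hx => Module.End.mem_eigenspace_iff.2 (h.layer_le_eigenspace hT n x hx))
      (h.iSup_layer_eq_top hT0 hT h1 h2 hc)
  obtain ⟨a, u, hu, hcu⟩ : ∃ a : k, ∃ u : M, u ≠ 0 ∧ c u = a • u := by
    by_cases hcv : c v = 0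
    · exact ⟨0, v, hv, by simpa using hcv⟩
    let φ : Polynomial k →ₗ[k] M := (LinearMap.applyₗ (c v)).comp (Polynomial.aeval c).toLinearMap
    have hφ : ∀ q, φ q = Polynomial.aeval c (q * Polynomial.X) v := fun q => by simp [φ]
    have hle := main (LinearMap.range φ) ?_ ?_ ?_ ?_ ?_ μ
    · have hmem : v ∈ LinearMap.range φ := by
        refine (iSup_le fun n => ?_ : _ ≤ LinearMap.range φ)
          (hle (Module.End.mem_eigenspace_iff.2 h0))
        obtain ⟨n, hn⟩ := n
        obtain rfl : n = 0 := by simpa using hn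
        exact le_rfl
      obtain ⟨q, hq⟩ := hmem
      refine exists_eigenvector_of_aeval_apply_eq_zero c hv _ (q * Polynomial.X - 1) rfl ?_ ?_
      · intro hq0
        simpa using congrArg (Polynomial.eval 0) hq0
      · rw [map_sub, LinearMap.sub_apply, ← hφ, hq]
        simp
    · intro hbot
      refine hcv ((Submodule.mem_bot k).1 (hbot ▸ ⟨1, ?_⟩))
      simp [φ]
    · rintro _ ⟨q, rfl⟩
      rw [hφ, h.apply_aeval_central, h0, map_smul]
    · rintro _ ⟨q, rfl⟩
      rw [hφ, h.apply_aeval_central, h1, map_zero]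
    · rintro _ ⟨q, rfl⟩
      rw [hφ, h.apply_aeval_central, h2, map_zero]
    · rintro _ ⟨q, rfl⟩
      exact ⟨Polynomial.X * q, by simp [φ]⟩
  have hc := h.central_eq_smul hu hcu
  have hspan : ∀ f : End k M, ∀ b : k, f v = b • v → ∀ x ∈ k ∙ v, f x = b • x := by
    intro f b hf x hx
    obtain ⟨t, rfl⟩ := Submodule.mem_span_singleton.1 hx
    rw [map_smul, hf, smul_comm]
  have hle := main (k ∙ v) (by simpa using hv) (hspan _ _ h0)
    (by simpa using hspan (e 1) 0 (by simpa using h1))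
    (by simpa using hspan (e 2) 0 (by simpa using h2))
    (fun x hx => hc x ▸ Submodule.smul_mem _ _ hx) ν
  have : Finite {n : ℕ // μ - n = ν} :=
    have : Subsingleton {n : ℕ // μ - n = ν} :=
      ⟨fun m n => Subtype.ext (inj (m.2.trans n.2.symm))⟩
    inferInstance
  exact Submodule.finiteDimensional_of_le hle

end HighestWeight

theorem eq_zero_of_highest_weight [CharZero k] [IsAlgClosed k] (h : IsSimpleVirasoroAction e c)
    {ν : k} (hinf : ¬ FiniteDimensional k ((e 0).eigenspace ν)) (μ : k) (x : M)
    (h0 : e 0 x = μ • x) (h1 : e 1 x = 0) (h2 : e 2 x = 0) : x = 0 := by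
  by_contra hx
  exact hinf (h.finiteDimensional_eigenspace_of_highest_weight hx h0 h1 h2 _)

theorem eq_zero_of_lowest_weight [CharZero k] [IsAlgClosed k] (h : IsSimpleVirasoroAction e c)
    {ν : k} (hinf : ¬ FiniteDimensional k ((e 0).eigenspace ν)) (μ : k) (x : M)
    (h0 : e 0 x = μ • x) (h1 : e (-1) x = 0) (h2 : e (-2) x = 0) : x = 0 := by
  refine h.reflect.eq_zero_of_highest_weight (ν := -ν) ?_ (-μ) x ?_ ?_ ?_
  · rwa [neg_zero, eigenspace_neg, neg_neg]
  · simpa using h0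
  · simpa using h1
  · simpa using h2

/-- The consequence of the degree-five relation among the positive operators. -/
theorem apply_one_apply_one_eq [CharZero k] (h : IsSimpleVirasoroAction e c) {ν : k} {v : M}
    (hν : ν ≠ 1) (h0 : e 0 v = (ν - 1) • v) (h1 : e 1 v = 0) (h12 : e (-1) (e 2 v) = 0) :
    e 1 (e 1 (e 2 v)) = (2 : k) • e 2 (e 2 v) := by
  set w := e 2 v with hw
  have e3 : e 3 v = e 1 w := by
    have := h.bracket 1 2 3 1 (by norm_num) v
    rw [h1, map_zero] at this
    linear_combination (norm := module) -this
  have e4 : (2 : k) • e 4 v = e 1 (e 1 w) := by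
    have := h.bracket 1 3 4 2 (by norm_num) v
    rw [h1, map_zero, e3] at this
    linear_combination (norm := module) -this
  have e5 : (6 : k) • e 5 v = e 1 (e 1 (e 1 w)) := by
    have := h.bracket 1 4 5 3 (by norm_num) v
    rw [h1, map_zero] at this
    rw [← e4, map_smul]
    linear_combination (norm := module) (-2 : k) • this
  have rel : e 1 (e 1 (e 1 w)) - (6 : k) • e 2 (e 1 w) + (6 : k) • e 3 w = 0 := by
    have := h.bracket 2 3 5 1 (by norm_num) v
    rw [e3, ← hw] at this
    linear_combination (norm := module) (-6 : k) • this - e5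
  have w0 : e 0 w = (ν + 1) • w := h.weight_apply h0 2 _ (by push_cast; ring)
  have w1 : e 0 (e 1 w) = (ν + 2) • e 1 w := h.weight_apply w0 1 _ (by push_cast; ring)
  have w2 : e 0 (e 1 (e 1 w)) = (ν + 3) • e 1 (e 1 w) :=
    h.weight_apply w1 1 _ (by push_cast; ring)
  have f1 : e (-1) (e 1 w) = (2 * (ν + 1)) • w := by
    rw [h.bracket_zero (-1) 1 2 0 (by norm_num) w, h12, w0, map_zero]
    module
  have f2 : e (-1) (e 1 (e 1 w)) = (4 * ν + 6) • e 1 w := by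
    rw [h.bracket_zero (-1) 1 2 0 (by norm_num) (e 1 w), f1, w1, map_smul]
    module
  have f3 : e (-1) (e 1 (e 1 (e 1 w))) = (6 * ν + 12) • e 1 (e 1 w) := by
    rw [h.bracket_zero (-1) 1 2 0 (by norm_num) (e 1 (e 1 w)), f2, w2, map_smul]
    module
  have g : e (-1) (e 2 (e 1 w)) = (2 * (ν + 1)) • e 2 w + (3 : k) • e 1 (e 1 w) := by
    rw [h.bracket (-1) 2 1 3 (by norm_num), f1, map_smul]
  have g' : e (-1) (e 3 w) = (4 : k) • e 2 w := by
    rw [h.bracket (-1) 3 2 4 (by norm_num), h12, map_zero, zero_add]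
  have key := congrArg (e (-1)) rel
  simp only [map_add, map_sub, map_smul, map_zero, f3, g, g'] at key
  have hν' : ν - 1 ≠ 0 := sub_ne_zero.2 hν
  have : (6 * (ν - 1)) • (e 1 (e 1 w) - (2 : k) • e 2 w) = 0 := by
    linear_combination (norm := module) key
  rw [smul_eq_zero_iff_right (by simpa using hν')] at this
  exact sub_eq_zero.1 this

theorem weight_eq_zero_of_apply_one_apply_one_eq [CharZero k] (h : IsSimpleVirasoroAction e c)
    {ν : k} {w : M} (w0 : e 0 w = (ν + 1) • w) (hw : e (-1) w = 0)
    (rel : e 1 (e 1 w) = (2 : k) • e 2 w) (hne : ¬ (e 1 w = 0 ∧ e 2 w = 0)) : ν = 0 := by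
  by_contra hν
  have w1 : e 0 (e 1 w) = (ν + 2) • e 1 w := h.weight_apply w0 1 _ (by push_cast; ring)
  have f1 : e (-1) (e 1 w) = (2 * (ν + 1)) • w := by
    rw [h.bracket_zero (-1) 1 2 0 (by norm_num) w, hw, w0, map_zero]
    module
  have f2 : e (-1) (e 1 (e 1 w)) = (4 * ν + 6) • e 1 w := by
    rw [h.bracket_zero (-1) 1 2 0 (by norm_num) (e 1 w), f1, w1, map_smul]
    module
  have g : e (-1) (e 2 w) = (3 : k) • e 1 w := by
    rw [h.bracket (-1) 2 1 3 (by norm_num), hw, map_zero, zero_add]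
  have key := congrArg (e (-1)) rel
  rw [map_smul, f2, g] at key
  have : (4 * ν) • e 1 w = 0 := by linear_combination (norm := module) key
  have hw1 : e 1 w = 0 := by simpa [hν] using this
  refine hne ⟨hw1, ?_⟩
  rw [hw1, map_zero] at rel
  simpa using rel.symm

theorem apply_eq_apply_add_two [CharZero k] (h : IsSimpleVirasoroAction e c)
    (hc : ∀ x, c x = 0)
    (hinj : ∀ (μ : k) (x : M), e 0 x = μ • x → e (-1) x = 0 → e (-2) x = 0 → x = 0)
    {v w : M} (v0 : e 0 v = -v) (v1 : e 1 v = 0) (v2 : e 2 v = w) (w0 : e 0 w = w)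
    (w1 : e (-1) w = 0) (w2 : e (-2) w = -v) (n : ℕ) : e n w = e (n + 2) v := by
  have comm : ∀ (i j : ℤ) (x : M), e i (e j x) = e j (e i x) + ((j : k) - i) • e (i + j) x :=
      fun i j x => by
    rw [h.comm i j x, hc x, smul_zero, add_zero]
  have e1 : ∀ n : ℤ, e 1 (e n v) = ((n : k) - 1) • e (n + 1) v := fun n => by
    simp [comm 1 n, v1, add_comm]
  have succ_ne : ∀ n : ℕ, (n : k) + 1 ≠ 0 := fun n => by exact_mod_cast n.succ_ne_zero
  have neg_one : ∀ n : ℕ, e (n + 2) (e (-1) v) = (-2 : k) • e (n + 1) v := fun n => by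
    induction n with
    | zero =>
      have := comm 2 (-1) v
      norm_num [v2, w1, v1] at this
      simpa [v1] using this
    | succ n ih =>
      have key := comm 1 (n + 2) (e (-1) v)
      have s := comm 1 (-1) v
      rw [v1, map_zero] at s
      norm_num [v0] at s
      rw [ih, s, map_smul, e1, map_smul] at key
      refine smul_right_injective M (succ_ne n) ?_
      have a1 : (1 : ℤ) + (n + 2) = n + 1 + 2 := by ring
      have a2 : (n : ℤ) + 1 + 1 = n + 2 := by ring
      push_cast
      rw [a1, a2] at key
      rw [a2]
      push_cast at key
      linear_combination (norm := module) -key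
  have neg_two : ∀ n : ℕ, e (n + 2) (e (-2) v) = (-3 : k) • e n v := fun n => by
    induction n with
    | zero =>
      have := comm 2 (-2) v
      norm_num [v2, w2, v0] at this
      simp only [Nat.cast_zero, zero_add, this, v0]
      module
    | succ n ih =>
      have key := comm 1 (n + 2) (e (-2) v)
      have s := comm 1 (-2) v
      rw [v1, map_zero] at s
      norm_num at s
      rw [ih, s, map_smul, e1, map_neg, map_smul, neg_one] at key
      refine smul_right_injective M (succ_ne n) ?_
      have a1 : (1 : ℤ) + (n + 2) = n + 1 + 2 := by ring
      push_cast
      rw [a1] at key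
      push_cast at key
      linear_combination (norm := module) -key
  have weight : ∀ n : ℕ, e 0 (e n w - e (n + 2) v) = ((n : k) + 1) • (e n w - e (n + 2) v) :=
    fun n => by
      rw [map_sub, comm 0, comm 0 (n + 2), w0, v0, map_neg, zero_add, zero_add]
      push_cast
      module
  induction n using Nat.twoStepInduction with
  | zero => simp [w0, v2]
  | one =>
    have := comm 1 2 v
    norm_num [v1, v2] at this
    simpa using this
  | more n ih ih' =>
    refine sub_eq_zero.1 (hinj _ _ (weight _) ?_ ?_)
    · have s := neg_one (n + 2)
      have a1 : (-1 : ℤ) + ((n + 2 : ℕ) + 2) = n + 3 := by push_cast; ring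
      have a2 : (-1 : ℤ) + (n + 2 : ℕ) = (n + 1 : ℕ) := by push_cast; ring
      have a3 : (((n + 2 : ℕ) : ℤ) + 1) = n + 3 := by push_cast; ring
      have a4 : (((n + 1 : ℕ) : ℤ) + 2) = n + 3 := by push_cast; ring
      rw [a3] at s
      rw [map_sub, comm (-1), comm (-1) ((n + 2 : ℕ) + 2), w1, map_zero, s, a1, a2, ih', a4]
      push_cast
      module
    · have s := neg_two (n + 2)
      have a1 : (-2 : ℤ) + ((n + 2 : ℕ) + 2) = n + 2 := by push_cast; ring
      have a2 : (-2 : ℤ) + (n + 2 : ℕ) = n := by push_cast; ring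
      have a3 : (((n + 2 : ℕ) : ℤ)) = n + 2 := by push_cast; ring
      rw [map_sub, comm (-2), comm (-2) ((n + 2 : ℕ) + 2), w2, map_neg, s, a1, a2, ih, a3]
      push_cast
      module

/-- A simple action containing a piece of the intermediate series around the weight `0` has
finite-dimensional weight spaces. -/
theorem finiteDimensional_eigenspace_of_intermediate [CharZero k]
    (h : IsSimpleVirasoroAction e c) (hc : ∀ x, c x = 0)
    (hinj : ∀ (μ : k) (x : M), e 0 x = μ • x → e 1 x = 0 → e 2 x = 0 → x = 0)
    (hinj' : ∀ (μ : k) (x : M), e 0 x = μ • x → e (-1) x = 0 → e (-2) x = 0 → x = 0)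
    {v w : M} (hv : v ≠ 0) (v0 : e 0 v = -v) (v1 : e 1 v = 0) (v2 : e 2 v = w)
    (w1 : e (-1) w = 0) (w2 : e (-2) w = -v) (ν : k) :
    FiniteDimensional k ((e 0).eigenspace ν) := by
  have w0 : e 0 w = w := by
    simpa [v2] using h.weight_apply (show e 0 v = (-1 : k) • v by simpa using v0) 2 1 (by norm_num)
  have nonneg : ∀ n : ℕ, e n w = e (n + 2) v :=
    h.apply_eq_apply_add_two hc hinj' v0 v1 v2 w0 w1 w2
  have nonpos : ∀ n : ℕ, e (-n) v = e (-(n + 2)) w := fun n => by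
    simpa using h.reflect.apply_eq_apply_add_two (v := w) (w := v) (by simpa using hc)
      (fun μ x hx h1 h2 => hinj (-μ) x (by simpa [neg_eq_iff_eq_neg] using hx)
        (by simpa using h1) (by simpa using h2))
      (by simpa using w0) (by simpa using w1) (by simp [w2]) (by simp [v0])
      (by simpa using v1) (by simpa using v2) n
  have all : ∀ n : ℤ, e (n - 2) w = e n v := fun n => by
    obtain hn | rfl | hn : 2 ≤ n ∨ n = 1 ∨ n ≤ 0 := by omega
    · obtain ⟨m, rfl⟩ : ∃ m : ℕ, n = m + 2 := ⟨(n - 2).toNat, by omega⟩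
      simpa using nonneg m
    · simpa [v1] using w1
    · obtain ⟨m, rfl⟩ : ∃ m : ℕ, n = -m := ⟨(-n).toNat, by omega⟩
      rw [nonpos m]
      congr 2
      ring
  have comm : ∀ (i j : ℤ) (x : M), e i (e j x) = e j (e i x) + ((j : k) - i) • e (i + j) x :=
      fun i j x => by
    rw [h.comm i j x, hc x, smul_zero, add_zero]
  have a1 : ∀ n : ℤ, e 1 (e n v) = ((n : k) - 1) • e (1 + n) v := fun n => by
    simp [comm 1 n, v1]
  have a2 : ∀ n : ℤ, e 2 (e n v) = ((n : k) - 1) • e (2 + n) v := fun n => by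
    rw [comm 2 n, v2, ← all (2 + n), add_sub_cancel_left]
    push_cast
    module
  have a1' : ∀ n : ℤ, e (-1) (e n v) = ((n : k) - 1) • e (-1 + n) v := fun n => by
    rw [← all n, comm (-1) (n - 2), w1, map_zero, ← all (-1 + n), ← add_sub_assoc]
    push_cast
    module
  have a2' : ∀ n : ℤ, e (-2) (e n v) = ((n : k) - 1) • e (-2 + n) v := fun n => by
    rw [← all n, comm (-2) (n - 2), w2, map_neg, ← add_sub_assoc, all, sub_eq_neg_add n 2]
    push_cast
    module
  have weight : ∀ n : ℤ, e 0 (e n v) = ((n : k) - 1) • e n v := fun n => by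
    simpa [v0, sub_eq_neg_add, add_smul] using comm 0 n v
  set S := ⨆ n : ℤ, k ∙ e n v with hS
  have stable : ∀ f : End k M, (∀ n : ℤ, f (e n v) ∈ S) → ∀ x ∈ S, f x ∈ S := by
    intro f hf
    have : S ≤ S.comap f := iSup_le fun n => by simpa using hf n
    exact this
  have mem : ∀ n : ℤ, e n v ∈ S := fun n =>
    le_iSup (fun n : ℤ => k ∙ e n v) n (Submodule.mem_span_singleton_self _)
  have htop : S = ⊤ := by
    refine (h.eq_bot_or_eq_top_of_generators
      (stable _ fun n => ?_) (stable _ fun n => ?_) (stable _ fun n => ?_)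
      (stable _ fun n => ?_)).resolve_left fun hbot => hv ?_
    · exact a1 n ▸ S.smul_mem _ (mem _)
    · exact a2 n ▸ S.smul_mem _ (mem _)
    · exact a1' n ▸ S.smul_mem _ (mem _)
    · exact a2' n ▸ S.smul_mem _ (mem _)
    · have := mem 0
      rwa [hbot, Submodule.mem_bot, v0, neg_eq_zero] at this
  have hle := eigenspace_le_iSup_of_iSup_eq_top (e 0) (fun n : ℤ => k ∙ e n v)
    (fun n => (n : k) - 1) (fun n => by
      simpa [Submodule.span_singleton_le_iff_mem, Module.End.mem_eigenspace_iff] using weight n)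
    htop ν
  have : Finite {n : ℤ // (n : k) - 1 = ν} :=
    have : Subsingleton {n : ℤ // (n : k) - 1 = ν} :=
      ⟨fun m n => Subtype.ext (by simpa using m.2.trans n.2.symm)⟩
    inferInstance
  exact Submodule.finiteDimensional_of_le hle

/-- If the weight space of weight `ν` is finite-dimensional and the one of weight `ν - 1` is not,
then `ν = 1`. -/
theorem eq_one_of_finiteDimensional [CharZero k] [IsAlgClosed k]
    (h : IsSimpleVirasoroAction e c) {ν : k}
    (hfin : FiniteDimensional k ((e 0).eigenspace ν))
    (hinf : ¬ FiniteDimensional k ((e 0).eigenspace (ν - 1))) : ν = 1 := by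
  have hinj : ∀ (μ : k) (x : M), e 0 x = μ • x → e 1 x = 0 → e 2 x = 0 → x = 0 := 
    h.eq_zero_of_highest_weight hinf
  have hinj' := h.eq_zero_of_lowest_weight hinf
  by_contra hν
  obtain ⟨v, hv, hv0, hker⟩ := exists_ne_zero_forall_apply_eq_zero ((e 0).eigenspace (ν - 1))
    (fun _ : Fin 3 => (e 0).eigenspace ν) ![e 1, e (-1) * e 2, e (-2) * e 1 * e 2]
    (fun i x hx => by
      rw [Module.End.mem_eigenspace_iff] at hx ⊢
      have h2 := h.weight_apply hx 2 (ν + 1) (by push_cast; ring)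
      have h12 := h.weight_apply h2 1 (ν + 2) (by push_cast; ring)
      fin_cases i
      · exact h.weight_apply hx 1 _ (by norm_num)
      · exact h.weight_apply h2 (-1) _ (by norm_num)
      · exact h.weight_apply h12 (-2) _ (by norm_num))
    (fun _ => hfin) hinf
  rw [Module.End.mem_eigenspace_iff] at hv
  have v1 : e 1 v = 0 := hker 0
  have w1 : e (-1) (e 2 v) = 0 := hker 1
  have hker2 : e (-2) (e 1 (e 2 v)) = 0 := hker 2
  have rel := h.apply_one_apply_one_eq hν hv v1 w1
  set w := e 2 v with hw
  have hw0 : w ≠ 0 := fun hw0 => hv0 (hinj _ v hv v1 hw0)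
  have wt := h.weight_apply hv 2 (ν + 1) (by push_cast; ring)
  rw [← hw] at wt
  obtain rfl := h.weight_eq_zero_of_apply_one_apply_one_eq wt w1 rel
    fun hw' => hw0 (hinj _ w wt hw'.1 hw'.2)
  have v0 : e 0 v = -v := by simpa using hv
  have w0 : e 0 w = w := by simpa using wt
  set u := e (-2) w with hu
  have hu0 : u ≠ 0 := fun hu0 => hw0 (hinj' _ w wt w1 hu0)
  have u0 : e 0 u = -u := by
    simpa [← hu] using h.weight_apply wt (-2) (-1) (by norm_num)
  have u1 : e 1 u = 0 := by
    have := h.bracket (-2) 1 (-1) 3 (by norm_num) w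
    rw [hker2, w1, smul_zero, add_zero] at this
    exact this.symm
  have rel' : e (-1) (e (-1) u) = (-2 : k) • e (-2) u := by
    have := h.reflect.apply_one_apply_one_eq (ν := 0) (v := w) zero_ne_one (by simpa using w0)
      (by simpa using w1) (by simpa using u1)
    simp only [LinearMap.neg_apply, map_neg, neg_neg, ← hu] at this
    linear_combination (norm := module) -this
  have hcw : (2 : k) • e 2 u = c w - (2 : k) • w := by
    have key := congrArg (e (-2)) rel
    have s1 := h.bracket (-2) 1 (-1) 3 (by norm_num) (e 1 w)
    have s2 := h.bracket_zero (-1) 1 2 0 (by norm_num) w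
    have s3 := h.bracket_zero (-2) 2 4 (-1 / 2) (by norm_num) w
    rw [w1, map_zero, w0] at s2
    rw [hker2, map_zero, s2] at s1
    rw [map_smul, s1, s3, w0] at key
    linear_combination (norm := module) -key
  have hcu : (2 : k) • u = c v - (2 : k) • v := by
    refine sub_eq_zero.1 (hinj (-1) _ ?_ ?_ ?_)
    · simp only [map_sub, map_smul, ← h.central, u0, v0, map_neg]
      module
    · simp only [map_sub, map_smul, ← h.central, u1, v1, map_zero, smul_zero, sub_zero]
    · simp only [map_sub, map_smul, ← h.central, ← hw, hcw, sub_self]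
  have hcu0 : c u = 0 := by
    have key := congrArg (e 2) rel'
    have s1 := h.bracket 2 (-1) 1 (-3) (by norm_num) (e (-1) u)
    have s2 := h.bracket 2 (-1) 1 (-3) (by norm_num) u
    have s3 := h.bracket_zero 1 (-1) (-2) 0 (by norm_num) u
    have s4 := h.bracket_zero 2 (-2) (-4) (1 / 2) (by norm_num) u
    have s5 := congrArg (e (-1)) hcw
    have s6 := congrArg (e (-2)) hcw
    simp only [map_sub, map_smul, ← h.central, w1, ← hu, map_zero, smul_zero, sub_zero] at s5 s6
    have s5' : e (-1) (e 2 u) = 0 := by simpa using s5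
    rw [u1, smul_zero, add_zero, s5'] at s2
    rw [u1, map_zero, u0] at s3
    rw [s2, map_zero, s3] at s1
    rw [map_smul, s1, s4, u0] at key
    linear_combination (norm := module) (1 / 2 : k) • key - (1 / 2 : k) • s6
  have hc : ∀ x, c x = 0 := fun x => by
    simpa using h.central_eq_smul hu0 (a := 0) (by simpa using hcu0) x
  have huv : u = -v := by
    rw [hc v] at hcu
    linear_combination (norm := module) (1 / 2 : k) • hcu
  exact hinf (h.finiteDimensional_eigenspace_of_intermediate hc hinj hinj' hv0 v0 v1 rfl w1 huv _)

theorem finiteDimensional_eigenspace_sub_one [CharZero k] [IsAlgClosed k]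
    (h : IsSimpleVirasoroAction e c) {ν : k}
    (hfin : FiniteDimensional k ((e 0).eigenspace ν)) :
    FiniteDimensional k ((e 0).eigenspace (ν - 1)) := by
  by_contra hinf
  obtain rfl := h.eq_one_of_finiteDimensional hfin hinf
  by_cases hfin' : FiniteDimensional k ((e 0).eigenspace (2 : k))
  · obtain ⟨v, hv, hv0, hker⟩ := exists_ne_zero_forall_apply_eq_zero
      ((e 0).eigenspace (1 - 1 : k)) (fun i : Fin 2 => (e 0).eigenspace (![1, 2] i)) ![e 1, e 2]
      (fun i x hx => by
        rw [Module.End.mem_eigenspace_iff] at hx ⊢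
        fin_cases i
        · exact h.weight_apply hx 1 _ (by norm_num)
        · exact h.weight_apply hx 2 _ (by norm_num))
      (fun i => by fin_cases i <;> assumption) hinf
    rw [Module.End.mem_eigenspace_iff] at hv
    exact hinf (h.finiteDimensional_eigenspace_of_highest_weight hv0 hv (hker 0) (hker 1) _)
  · have := h.reflect.eq_one_of_finiteDimensional (ν := -1)
      (by rwa [neg_zero, eigenspace_neg, neg_neg])
      (by rwa [neg_zero, eigenspace_neg, neg_sub, sub_neg_eq_add, one_add_one_eq_two])
    norm_num [neg_eq_iff_eq_neg] at this

theorem finiteDimensional_eigenspace_add_one [CharZero k] [IsAlgClosed k]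
    (h : IsSimpleVirasoroAction e c) {ν : k}
    (hfin : FiniteDimensional k ((e 0).eigenspace ν)) :
    FiniteDimensional k ((e 0).eigenspace (ν + 1)) := by
  have := h.reflect.finiteDimensional_eigenspace_sub_one (ν := -ν)
    (by rwa [neg_zero, eigenspace_neg, neg_neg])
  rwa [neg_zero, eigenspace_neg, neg_sub, sub_neg_eq_add, add_comm] at this

theorem finiteDimensional_eigenspace_of_add_int [CharZero k] [IsAlgClosed k]
    (h : IsSimpleVirasoroAction e c) (ν : k) (i : ℤ)
    (hfin : FiniteDimensional k ((e 0).eigenspace (ν + i))) :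
    FiniteDimensional k ((e 0).eigenspace ν) := by
  induction i using Int.induction_on with
  | zero => rwa [Int.cast_zero, add_zero] at hfin
  | succ i ih =>
    refine ih ?_
    have := h.finiteDimensional_eigenspace_sub_one hfin
    rwa [Int.cast_add, Int.cast_one, ← add_assoc, add_sub_cancel_right] at this
  | pred i ih =>
    refine ih ?_
    have := h.finiteDimensional_eigenspace_add_one hfin
    rwa [Int.cast_sub, Int.cast_one, add_assoc, sub_add_cancel] at this

end IsSimpleVirasoroAction

theorem LieModule.isSimpleVirasoroAction
    {k : Type*} [Field k] {L : Type*} [LieRing L] [LieAlgebra k L]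
    (E : ℤ → L) (C : L) (hC : ∀ z : L, ⁅C, z⁆ = 0)
    (hE : ∀ i j : ℤ, ⁅E i, E j⁆ =
      (j - i) • E (i + j) + (if i + j = 0 then ((i : k) ^ 3 - (i : k)) / 12 else 0) • C)
    (hspan : Submodule.span k ({C} ∪ Set.range E) = ⊤)
    {M : Type*} [AddCommGroup M] [Module k M] [LieRingModule L M] [LieModule k L M]
    [LieModule.IsIrreducible k L M] :
    IsSimpleVirasoroAction (fun i => LieModule.toEnd k L M (E i)) (LieModule.toEnd k L M C) where
  central i x := by
    simp only [LieModule.toEnd_apply_apply]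
    rw [leibniz_lie, hC, zero_lie, zero_add]
  comm i j x := by
    simp only [LieModule.toEnd_apply_apply]
    rw [leibniz_lie, hE, add_lie, ← Int.cast_smul_eq_zsmul k, smul_lie, smul_lie]
    push_cast
    abel
  eq_bot_or_eq_top S hS hc := by
    have hstable : ∀ z : L, ∀ x ∈ S, ⁅z, x⁆ ∈ S := fun z x hx => by
      have hz : z ∈ Submodule.span k ({C} ∪ Set.range E) := hspan ▸ Submodule.mem_top
      induction hz using Submodule.span_induction with
      | mem z hz =>
        obtain rfl | ⟨i, rfl⟩ := hz
        · exact hc x hx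
        · exact hS i x hx
      | zero => simp
      | add y z _ _ hy hz =>
        rw [add_lie]
        exact add_mem hy hz
      | smul a z _ hz =>
        rw [smul_lie]
        exact S.smul_mem a hz
    let N : LieSubmodule k L M := { S with lie_mem := fun {z x} hx => hstable z x hx }
    obtain hN | hN := eq_bot_or_eq_top N
    · exact Or.inl (by simpa [N] using congrArg LieSubmodule.toSubmodule hN)
    · exact Or.inr (by simpa [N] using congrArg LieSubmodule.toSubmodule hN)

end VirasoroAction


/-- There are no simple mixed modules over the Virasoro algebra: no simple
weight `V`-module `M` admits `λ ∈ k` and `i ∈ ℤ` with `dim M_λ = ∞` and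
`dim M_{λ+i} < ∞`. -/
theorem virasoro_no_simple_mixed_modules
    {k : Type*} [Field k] [CharZero k] [IsAlgClosed k]
    {L : Type*} [LieRing L] [LieAlgebra k L]
    (E : ℤ → L) (C : L)
    (hC : ∀ z : L, ⁅C, z⁆ = 0)
    (hE : ∀ i j : ℤ, ⁅E i, E j⁆ =
      (j - i) • E (i + j) + (if i + j = 0 then ((i : k) ^ 3 - (i : k)) / 12 else 0) • C)
    (hspan : Submodule.span k ({C} ∪ Set.range E) = ⊤)
    {M : Type*} [AddCommGroup M] [Module k M] [LieRingModule L M] [LieModule k L M]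
    [LieModule.IsIrreducible k L M]
    (hweight : (⨆ μ : k, Module.End.eigenspace (LieModule.toEnd k L M (E 0)) μ) = ⊤) :
    ¬ ∃ (lam : k) (i : ℤ),
      (¬ FiniteDimensional k
        ↥(Module.End.eigenspace (LieModule.toEnd k L M (E 0)) lam)) ∧
      FiniteDimensional k
        ↥(Module.End.eigenspace (LieModule.toEnd k L M (E 0)) (lam + i)) := by
  rintro ⟨lam, i, hinf, hfin⟩
  exact hinf ((LieModule.isSimpleVirasoroAction E C hC hE hspan
    ).finiteDimensional_eigenspace_of_add_int lam i hfin)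
end
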